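/- Let W be an open subanalytic subset of ℙ¹(ℂ) with ∞ ∉ W, and write z = x + iy for the affine coordinate. If there exist a positive constant C and a positive integer N such that exp(x) ≤ C(1 + x² + y²)^N for all z = x + iy ∈ W, then there exists a constant B such that x ≤ B on W. -/

import Mathlib

/-!
Kashiwara–Schapira, "Ind-sheaves, temperate holomorphic functions and irregularity",
Lemma 7.2 (`le:expbnd`): let `W` be an open subanalytic subset of `ℙ¹(ℂ)` with
`∞ ∉ W`, and write `z = x + iy`.  If there are a positive constant `C` and a
positive integer `N` with `exp(x) ≤ C(1 + x² + y²)^N` on `W`, then there is a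
constant `B` with `x ≤ B` on `W`.

Here `ℙ¹(ℂ)` is realized as the one-point compactification `OnePoint ℂ` of `ℂ`;
subanalyticity of subsets of `ℂ` (as a real analytic 2-dimensional space) is
defined via relatively compact semianalytic sets, and subanalyticity in `ℙ¹(ℂ)`
is required in the chart at every finite point and in the chart `w = 1/z` at `∞`.
-/

open scoped OnePoint

namespace KS

/-- A subset `s` of a real normed space is *semianalytic* if every point has an
open neighborhood `U` on which `s` is a finite union of finite intersections of
sets of the form `{f = 0}` and `{g > 0}`, with `f`, `g` real analytic on `U`. -/
def Semianalytic {E : Type*} [NormedAddCommGroup E] [NormedSpace ℝ E]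
    (s : Set E) : Prop :=
  ∀ x : E, ∃ U : Set E, IsOpen U ∧ x ∈ U ∧
    ∃ (N : ℕ) (f g : Fin N → Fin N → E → ℝ),
      (∀ i j, AnalyticOnNhd ℝ (f i j) U) ∧ (∀ i j, AnalyticOnNhd ℝ (g i j) U) ∧
      s ∩ U = (⋃ i, ⋂ j, {y | f i j y = 0} ∩ {y | 0 < g i j y}) ∩ U

/-- A subset `s` of a real normed space is *subanalytic at a point* `x` if `x`
has an open neighborhood `U` such that `s ∩ U` is the projection of a relatively
compact semianalytic subset of `E × ℝ^m` for some `m`. -/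
def SubanalyticAt {E : Type*} [NormedAddCommGroup E] [NormedSpace ℝ E]
    (s : Set E) (x : E) : Prop :=
  ∃ U : Set E, IsOpen U ∧ x ∈ U ∧
    ∃ (m : ℕ) (A : Set (E × EuclideanSpace ℝ (Fin m))),
      Semianalytic A ∧ IsCompact (closure A) ∧ s ∩ U = (Prod.fst '' A) ∩ U

/-- A subset `W` of `ℙ¹(ℂ) = OnePoint ℂ` is *subanalytic* if it is subanalytic
at every finite point (in the chart `z`) and at `∞` (in the chart `w = 1/z`,
where `w = 0` corresponds to `∞`). -/
def SubanalyticP1 (W : Set (OnePoint ℂ)) : Prop :=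
  (∀ x : ℂ, SubanalyticAt {z : ℂ | (z : OnePoint ℂ) ∈ W} x) ∧
  SubanalyticAt
    {w : ℂ | (if w = 0 then (∞ : OnePoint ℂ) else ((w⁻¹ : ℂ) : OnePoint ℂ)) ∈ W}
    (0 : ℂ)

section

open Filter Topology Set Polynomial

/-- A monotone labelling of the points of `ℝ` which separates the points of `Z` from all other
points and is locally constant off `Z`. -/
structure Cells {J : Type*} [LinearOrder J] (c : ℝ → J) (Z : Set ℝ) : Prop where
  mono : Monotone c
  loc : ∀ x, x ∉ Z → ∀ᶠ y in 𝓝 x, c y = c x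
  single : ∀ x y, x ∈ Z → c x = c y → x = y

theorem Cells.exists_sup {J : Type*} [LinearOrder J] {c : ℝ → J} {Z : Set ℝ} (h : Cells c Z)
    {x : ℝ} (hx : x ∉ Z) (hb : BddAbove {y | c y = c x}) :
    ∃ b ∈ Z, IsLUB {y | c y = c x} b ∧ c x < c b := by
  obtain ⟨b, hl⟩ : ∃ b, IsLUB {y | c y = c x} b := ⟨_, isLUB_csSup ⟨x, rfl⟩ hb⟩
  have hxb : x ≤ b := hl.1 rfl
  have hne : c b ≠ c x := by
    intro hcb
    have hbZ : b ∉ Z := fun hbZ => hx (h.single b x hbZ hcb ▸ hbZ)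
    have h1 : ∀ᶠ y in 𝓝[>] b, c y = c b := (h.loc b hbZ).filter_mono nhdsWithin_le_nhds
    obtain ⟨y, hy, hyb⟩ := (h1.and self_mem_nhdsWithin).exists
    exact absurd (hl.1 (hy.trans hcb)) (not_le.2 hyb)
  refine ⟨b, ?_, hl, lt_of_le_of_ne (h.mono hxb) hne.symm⟩
  by_contra hbZ
  have hmem : b ∈ closure {y | c y = c x} := hl.mem_closure ⟨x, rfl⟩
  obtain ⟨y, hy1, hy2⟩ := mem_closure_iff_nhds.1 hmem _ (h.loc b hbZ)
  exact hne (hy1.symm.trans hy2)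

theorem eventually_sign_eval_eq (A : ℝ[X]) :
    ∀ᶠ x in atTop, SignType.sign (A.eval x) = SignType.sign A.leadingCoeff := by
  rcases eq_or_ne A 0 with rfl | hA
  · simp
  have h := A.isEquivalent_atTop_lead
  have h1 : ∀ᶠ x : ℝ in atTop, SignType.sign (A.leadingCoeff * x ^ A.natDegree)
      = SignType.sign A.leadingCoeff := by
    filter_upwards [eventually_gt_atTop 0] with x hx
    rw [sign_mul, sign_pos (pow_pos hx _), mul_one]
  obtain ⟨f, hf, hfA⟩ := h.exists_eq_mul
  filter_upwards [h1, hfA, hf.eventually (lt_mem_nhds zero_lt_one)] with x h1 h2 h3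
  rw [h2, Pi.mul_apply, sign_mul, sign_pos h3, one_mul, h1]

theorem exists_pos_of_pos {J : Type*} [LinearOrder J] {c c' : ℝ → J} {Z Z' : Set ℝ}
    (h : Cells c Z) (h' : Cells c' Z') (hr : range c = range c')
    (corr : ∀ z w, c z = c' w → (z ∈ Z ↔ w ∈ Z')) (A B : ℝ[X])
    (hroot : ∀ z ∈ Z, ∀ w, c z = c' w →
      SignType.sign (A.eval z) = SignType.sign (B.eval w))
    (hlc : SignType.sign A.leadingCoeff = SignType.sign B.leadingCoeff) {x : ℝ} (hx : x ∉ Z)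
    (hA : ∀ u, c u = c x → x < u → A.eval x < A.eval u) (pos : 0 < A.eval x) :
    ∃ y, c' y = c x ∧ 0 < B.eval y := by
  obtain ⟨y₀, hy₀⟩ : c x ∈ range c' := hr ▸ mem_range_self x
  have hy₀Z : y₀ ∉ Z' := fun hh => hx ((corr x y₀ hy₀.symm).2 hh)
  by_contra! hcon
  by_cases hb' : BddAbove {y | c' y = c x}
  · rw [← hy₀] at hb'
    obtain ⟨β, hβZ, hβ, hβc⟩ := h'.exists_sup hy₀Z hb'
    obtain ⟨b, hb⟩ : c' β ∈ range c := hr ▸ mem_range_self β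
    have hbI : BddAbove {y | c y = c x} := by
      refine ⟨b, fun u (hu : c u = c x) => ?_⟩
      by_contra! hlt
      have := h.mono hlt.le
      rw [hb, hu, ← hy₀] at this
      exact absurd this (not_le.2 hβc)
    obtain ⟨b₀, hb₀Z, hb₀, hb₀c⟩ := h.exists_sup hx hbI
    obtain ⟨β₀, hβ₀⟩ : c b₀ ∈ range c' := hr ▸ mem_range_self b₀
    have h1 : β ≤ β₀ := by
      refine hβ.2 fun u (hu : c' u = c' y₀) => ?_
      by_contra! hlt
      have := h'.mono hlt.le
      rw [hβ₀, hu, hy₀] at this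
      exact absurd this (not_le.2 hb₀c)
    have h2 : b₀ ≤ b := by
      refine hb₀.2 fun u (hu : c u = c x) => ?_
      by_contra! hlt
      have := h.mono hlt.le
      rw [hb, hu, ← hy₀] at this
      exact absurd this (not_le.2 hβc)
    have h3 : c' β = c' β₀ := by
      refine le_antisymm (h'.mono h1) ?_
      rw [hβ₀, ← hb]; exact h.mono h2
    have h4 := h'.single β β₀ hβZ h3
    subst h4
    have hs := hroot b₀ hb₀Z β hβ₀.symm
    have hB : B.eval β ≤ 0 := by
      have hcl : β ∈ closure {y | c' y = c' y₀} := hβ.mem_closure ⟨y₀, rfl⟩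
      have : closure {y | c' y = c' y₀} ⊆ {y | B.eval y ≤ 0} :=
        closure_minimal (fun y hy => hcon y (hy.trans hy₀))
          (isClosed_le B.continuous continuous_const)
      exact this hcl
    have hAb : 0 < A.eval b₀ := by
      refine pos.trans_le ?_
      have hcl : b₀ ∈ closure {y | c y = c x} := hb₀.mem_closure ⟨x, rfl⟩
      by_contra! hlt
      have hxb : x < b₀ := by
        rcases (hb₀.1 (rfl : c x = c x)).lt_or_eq with h | h
        · exact h
        · rw [h] at hlt; exact absurd hlt (lt_irrefl _)
      have hopen : {y | A.eval y < A.eval x} ∩ Ioi x ∈ 𝓝 b₀ :=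
        inter_mem ((isOpen_lt A.continuous continuous_const).mem_nhds hlt) (Ioi_mem_nhds hxb)
      obtain ⟨y, ⟨hy1, hy2⟩, hy3⟩ := mem_closure_iff_nhds.1 hcl _ hopen
      exact absurd (hA y hy3 hy2) (not_lt.2 (le_of_lt hy1))
    rw [sign_pos hAb] at hs
    exact absurd (sign_eq_one_iff.1 hs.symm) (not_lt.2 hB)
  · have hI : ¬ BddAbove {y | c y = c x} := by
      intro hbI
      obtain ⟨b₀, hb₀Z, hb₀, hb₀c⟩ := h.exists_sup hx hbI
      obtain ⟨β₀, hβ₀⟩ : c b₀ ∈ range c' := hr ▸ mem_range_self b₀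
      refine hb' ⟨β₀, fun u (hu : c' u = c x) => ?_⟩
      by_contra! hlt
      have := h'.mono hlt.le
      rw [hβ₀, hu] at this
      exact absurd this (not_le.2 hb₀c)
    obtain ⟨a, ha⟩ := eventually_atTop.1 (eventually_sign_eval_eq A)
    obtain ⟨b, hb⟩ := eventually_atTop.1 (eventually_sign_eval_eq B)
    obtain ⟨u, hu, hua⟩ := not_bddAbove_iff.1 hI (max a x)
    obtain ⟨v, hv, hvb⟩ := not_bddAbove_iff.1 hb' b
    have h1 := ha u ((le_max_left _ _).trans hua.le)
    rw [sign_pos (pos.trans (hA u hu ((le_max_right _ _).trans_lt hua))), hlc, ← hb v hvb.le] at h1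
    exact absurd (sign_eq_one_iff.1 h1.symm) (not_lt.2 (hcon v hv))

theorem Cells.reflect {J : Type*} [LinearOrder J] {c : ℝ → J} {Z : Set ℝ} (h : Cells c Z) :
    Cells (fun x => OrderDual.toDual (c (-x))) (Neg.neg ⁻¹' Z) where
  mono x y hxy := OrderDual.toDual_le_toDual.2 (h.mono (neg_le_neg hxy))
  loc x hx := by
    have := (continuous_neg.tendsto x).eventually (h.loc (-x) hx)
    filter_upwards [this] with y hy
    rw [hy]
  single x y hx hxy := neg_injective (h.single _ _ hx (OrderDual.toDual.injective hxy))

theorem exists_neg_of_neg {J : Type*} [LinearOrder J] {c c' : ℝ → J} {Z Z' : Set ℝ}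
    (h : Cells c Z) (h' : Cells c' Z') (hr : range c = range c')
    (corr : ∀ z w, c z = c' w → (z ∈ Z ↔ w ∈ Z')) (A B : ℝ[X])
    (hroot : ∀ z ∈ Z, ∀ w, c z = c' w →
      SignType.sign (A.eval z) = SignType.sign (B.eval w))
    (hlc : SignType.sign A.leadingCoeff = SignType.sign B.leadingCoeff)
    (hdeg : A.natDegree = B.natDegree) {x : ℝ} (hx : x ∉ Z)
    (hA : ∀ u, c u = c x → u < x → A.eval u < A.eval x) (neg : A.eval x < 0) :
    ∃ y, c' y = c x ∧ B.eval y < 0 := by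
  have hlc' : ∀ A : ℝ[X], SignType.sign (-(A.comp (-X))).leadingCoeff
      = -(SignType.sign A.leadingCoeff * SignType.sign ((-1 : ℝ) ^ A.natDegree)) := by
    intro A
    rw [leadingCoeff_neg, leadingCoeff_comp (by simp), Left.sign_neg, sign_mul]
    simp
  obtain ⟨y, hy, hy'⟩ := exists_pos_of_pos h.reflect h'.reflect (x := -x) (by
      ext j
      constructor
      · rintro ⟨u, rfl⟩
        obtain ⟨v, hv⟩ : c (-u) ∈ range c' := hr ▸ mem_range_self _
        exact ⟨-v, by simp [hv]⟩
      · rintro ⟨u, rfl⟩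
        obtain ⟨v, hv⟩ : c' (-u) ∈ range c := hr ▸ mem_range_self _
        exact ⟨-v, by simp [hv]⟩)
    (fun z w hzw => corr _ _ (OrderDual.toDual.injective hzw))
    (-(A.comp (-X))) (-(B.comp (-X)))
    (fun z hz w hzw => by
      have := hroot _ hz _ (OrderDual.toDual.injective hzw)
      simp [Left.sign_neg, this])
    (by rw [hlc', hlc', hlc, hdeg]) (by simpa using hx)
    (fun u hu hxu => by
      have := hA (-u) (by simpa using hu) (by linarith)
      simpa using this) (by simpa using neg)
  exact ⟨-y, by simpa using hy, by simpa using hy'⟩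

end

section

open Filter Topology Set Polynomial

theorem exists_sign_eq {J : Type*} [LinearOrder J] {c c' : ℝ → J} {Z Z' : Set ℝ}
    (h : Cells c Z) (h' : Cells c' Z') (hr : range c = range c')
    (corr : ∀ z w, c z = c' w → (z ∈ Z ↔ w ∈ Z')) (A B : ℝ[X])
    (hroot : ∀ z ∈ Z, ∀ w, c z = c' w →
      SignType.sign (A.eval z) = SignType.sign (B.eval w))
    (hlc : SignType.sign A.leadingCoeff = SignType.sign B.leadingCoeff)
    (hdeg : A.natDegree = B.natDegree) {x : ℝ} (hx : x ∉ Z)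
    (hA : ∀ u v, c u = c x → c v = c x → u < v → A.eval u < A.eval v) :
    ∃ y, c' y = c x ∧ SignType.sign (A.eval x) = SignType.sign (B.eval y) := by
  have hcell : ∀ u, c u = c x → u ∉ Z := fun u hu huZ => hx (h.single u x huZ hu ▸ huZ)
  have up : ∀ u, c u = c x → 0 < A.eval u → ∃ y, c' y = c x ∧ 0 < B.eval y := fun u hu hpos => by
    obtain ⟨y, hy⟩ := exists_pos_of_pos h h' hr corr A B hroot hlc (hcell u hu)
      (fun v hv => hA u v hu (hv.trans hu)) hpos
    exact ⟨y, hu ▸ hy⟩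
  have down : ∀ u, c u = c x → A.eval u < 0 → ∃ y, c' y = c x ∧ B.eval y < 0 :=
    fun u hu hneg => by
      obtain ⟨y, hy⟩ := exists_neg_of_neg h h' hr corr A B hroot hlc hdeg (hcell u hu)
        (fun v hv => hA v u (hv.trans hu) hu) hneg
      exact ⟨y, hu ▸ hy⟩
  rcases lt_trichotomy (A.eval x) 0 with h0 | h0 | h0
  · obtain ⟨y, hy, hy'⟩ := down x rfl h0
    exact ⟨y, hy, by rw [sign_neg h0, sign_neg hy']⟩
  · have h1 : ∀ᶠ y in 𝓝[>] x, c y = c x := (h.loc x hx).filter_mono nhdsWithin_le_nhds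
    have h2 : ∀ᶠ y in 𝓝[<] x, c y = c x := (h.loc x hx).filter_mono nhdsWithin_le_nhds
    obtain ⟨v, hv, hxv⟩ := (h1.and self_mem_nhdsWithin).exists
    obtain ⟨u, hu, hux⟩ := (h2.and self_mem_nhdsWithin).exists
    obtain ⟨y₁, hy₁, hp⟩ := up v hv (h0 ▸ hA x v rfl hv hxv)
    obtain ⟨y₂, hy₂, hn⟩ := down u hu (h0 ▸ hA u x hu rfl hux)
    have hconn : ({y | c' y = c x} : Set ℝ).OrdConnected := by
      have : ({y | c' y = c x} : Set ℝ) = c' ⁻¹' {c x} := rfl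
      rw [this]
      exact ordConnected_singleton.preimage_mono h'.mono
    obtain ⟨y, hy, hy0⟩ := hconn.isPreconnected.intermediate_value hy₂ hy₁
      B.continuous.continuousOn ⟨hn.le, hp.le⟩
    exact ⟨y, hy, by rw [h0, show B.eval y = 0 from hy0]⟩
  · obtain ⟨y, hy, hy'⟩ := up x rfl h0
    exact ⟨y, hy, by rw [sign_pos h0, sign_pos hy']⟩

variable {R : Type*} [CommRing R]

/-- The zeros of those members of `S` which do not vanish identically at the point `φ`. -/
def zeros (S : Set R[X]) (φ : R →+* ℝ) : Set ℝ :=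
  {x | ∃ q ∈ S, q.map φ ≠ 0 ∧ (q.map φ).eval x = 0}

/-- The real lines over `φ` and `ψ` carry labellings with the same labels, compatible
with the signs of the members of `S`. -/
structure Compat (S : Set R[X]) (φ ψ : R →+* ℝ) {J : Type*} [LinearOrder J]
    (c c' : ℝ → J) : Prop where
  left : Cells c (zeros S φ)
  right : Cells c' (zeros S ψ)
  range_eq : range c = range c'
  sign_eq : ∀ q ∈ S, ∀ x y, c x = c' y →
    SignType.sign ((q.map φ).eval x) = SignType.sign ((q.map ψ).eval y)

/-- The labelling `c`, refined by the sign of a polynomial `P`; the sign is multiplied with that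
of the derivative in order to obtain a monotone labelling. -/
noncomputable def refineLabel {J : Type*} (c : ℝ → J) (P : ℝ[X]) (x : ℝ) : J ×ₗ SignType :=
  toLex (c x, SignType.sign (P.derivative.eval x) * SignType.sign (P.eval x))

theorem refineLabel_eq_iff {J : Type*} {c c' : ℝ → J} {P Q : ℝ[X]} {x y : ℝ} :
    refineLabel c P x = refineLabel c' Q y ↔
    c x = c' y ∧ SignType.sign (P.derivative.eval x) * SignType.sign (P.eval x)
      = SignType.sign (Q.derivative.eval y) * SignType.sign (Q.eval y) := by
  simp [refineLabel]

variable {S : Set R[X]} {φ ψ : R →+* ℝ} {J : Type*} [LinearOrder J] {c c' : ℝ → J}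

theorem Compat.symm (h : Compat S φ ψ c c') : Compat S ψ φ c' c where
  left := h.right
  right := h.left
  range_eq := h.range_eq.symm
  sign_eq q hq x y hxy := (h.sign_eq q hq y x hxy.symm).symm

theorem Compat.exists_right (h : Compat S φ ψ c c') (x : ℝ) : ∃ y, c x = c' y := by
  obtain ⟨y, hy⟩ : c x ∈ range c' := h.range_eq ▸ mem_range_self x
  exact ⟨y, hy.symm⟩

theorem Compat.sign_eq_left (h : Compat S φ ψ c c') {q : R[X]} (hq : q ∈ S) {x y : ℝ}
    (hxy : c x = c y) :
    SignType.sign ((q.map φ).eval x) = SignType.sign ((q.map φ).eval y) := by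
  obtain ⟨w, hw⟩ := h.exists_right x
  rw [h.sign_eq q hq x w hw, h.sign_eq q hq y w (hxy ▸ hw)]

theorem Compat.map_eq_zero (h : Compat S φ ψ c c') {q : R[X]} (hq : q ∈ S)
    (h0 : q.map ψ = 0) : q.map φ = 0 := by
  refine Polynomial.funext fun x => ?_
  obtain ⟨w, hw⟩ := h.exists_right x
  have := h.sign_eq q hq x w hw
  rw [h0, eval_zero, sign_zero, sign_eq_zero_iff] at this
  rw [this, eval_zero]

theorem Compat.mem_zeros (h : Compat S φ ψ c c') {x y : ℝ} (hxy : c x = c' y)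
    (hx : x ∈ zeros S φ) : y ∈ zeros S ψ := by
  obtain ⟨q, hq, h0, hqx⟩ := hx
  refine ⟨q, hq, fun hh => h0 (h.map_eq_zero hq hh), ?_⟩
  have := h.sign_eq q hq x y hxy
  rwa [hqx, sign_zero, eq_comm, sign_eq_zero_iff] at this

theorem eval_lt_eval_of_derivative_pos {A : ℝ[X]} {u v : ℝ} (huv : u < v)
    (h : ∀ w ∈ Icc u v, 0 < A.derivative.eval w) : A.eval u < A.eval v := by
  refine strictMonoOn_of_deriv_pos (convex_Icc u v) A.continuous.continuousOn (fun w hw => ?_)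
    (left_mem_Icc.2 huv.le) (right_mem_Icc.2 huv.le) huv
  rw [Polynomial.deriv]
  exact h w (interior_subset hw)

theorem Compat.strictMono (h : Compat S φ ψ c c') {p : R[X]} (hd : derivative p ∈ S) {u v : ℝ}
    (huv : u < v) (hc : c u = c v) :
    (0 < ((p.map φ).derivative).eval u → (p.map φ).eval u < (p.map φ).eval v) ∧
    (((p.map φ).derivative).eval u < 0 → (p.map φ).eval v < (p.map φ).eval u) := by
  have hw : ∀ w ∈ Icc u v, SignType.sign (((p.map φ).derivative).eval w)
      = SignType.sign (((p.map φ).derivative).eval u) := fun w hw => by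
    have := h.sign_eq_left hd (x := w) (y := u)
      (le_antisymm (hc ▸ h.left.mono hw.2) (h.left.mono hw.1))
    rwa [← derivative_map] at this
  constructor
  · intro h0
    refine eval_lt_eval_of_derivative_pos huv fun w hwI => ?_
    have := hw w hwI
    rwa [sign_pos h0, sign_eq_one_iff] at this
  · intro h0
    have : (-(p.map φ)).eval u < (-(p.map φ)).eval v := by
      refine eval_lt_eval_of_derivative_pos huv fun w hwI => ?_
      have := hw w hwI
      rw [sign_neg h0, sign_eq_neg_one_iff] at this
      simpa using this
    simpa using this

theorem Compat.derivative_ne_zero (h : Compat S φ ψ c c') {p : R[X]} (hd : derivative p ∈ S)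
    (hD : derivative (p.map φ) ≠ 0) {u v : ℝ} (huv : u < v) (hc : c u = c v) :
    (derivative (p.map φ)).eval u ≠ 0 := fun h0 =>
  huv.ne (h.left.single u v ⟨_, hd, by rwa [← derivative_map], by rwa [← derivative_map]⟩ hc)

theorem Compat.cells_refineLabel (h : Compat S φ ψ c c') {p : R[X]} (hd : derivative p ∈ S)
    (hD : derivative (p.map φ) ≠ 0) :
    Cells (refineLabel c (p.map φ)) (zeros (insert p S) φ) where
  mono u v huv := by
    rcases huv.eq_or_lt with rfl | huv
    · exact le_rfl
    rw [refineLabel, refineLabel, Prod.Lex.toLex_le_toLex]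
    rcases (h.left.mono huv.le).lt_or_eq with hlt | heq
    · exact Or.inl hlt
    refine Or.inr ⟨heq, ?_⟩
    have hs := h.sign_eq_left hd heq
    rw [← derivative_map] at hs
    obtain ⟨h1, h2⟩ := h.strictMono hd huv heq
    dsimp only
    rw [← hs]
    rcases lt_or_gt_of_ne (h.derivative_ne_zero hd hD huv heq) with h0 | h0
    · rw [sign_neg h0]
      have := SignType.sign.monotone (h2 h0).le
      revert this
      generalize SignType.sign (eval u (p.map φ)) = a
      generalize SignType.sign (eval v (p.map φ)) = b
      revert a b
      decide
    · rw [sign_pos h0, one_mul, one_mul]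
      exact SignType.sign.monotone (h1 h0).le
  loc x hx := by
    have hxS : x ∉ zeros S φ := fun ⟨q, hq, hh⟩ => hx ⟨q, mem_insert_of_mem _ hq, hh⟩
    have hP : (p.map φ).eval x ≠ 0 := fun h0 =>
      hx ⟨p, mem_insert _ _, fun hh => hD (by rw [hh, derivative_zero]), h0⟩
    have hs : ∀ᶠ y in 𝓝 x, SignType.sign ((p.map φ).eval y)
        = SignType.sign ((p.map φ).eval x) := by
      rcases lt_or_gt_of_ne hP with h0 | h0
      · filter_upwards [(p.map φ).continuous.continuousAt.eventually (gt_mem_nhds h0)] with y hy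
        rw [sign_neg h0, sign_neg hy]
      · filter_upwards [(p.map φ).continuous.continuousAt.eventually (lt_mem_nhds h0)] with y hy
        rw [sign_pos h0, sign_pos hy]
    filter_upwards [hs, h.left.loc x hxS] with y hy hc
    have := h.sign_eq_left hd hc
    rw [← derivative_map] at this
    exact refineLabel_eq_iff.2 ⟨hc, by rw [hy, this]⟩
  single x y hx hxy := by
    obtain ⟨hc, hs⟩ := refineLabel_eq_iff.1 hxy
    obtain ⟨q, hq, hq0, hqx⟩ := hx
    rcases mem_insert_iff.1 hq with rfl | hq
    · rw [hqx, sign_zero, mul_zero, eq_comm, mul_eq_zero, sign_eq_zero_iff, sign_eq_zero_iff] at hs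
      by_contra hne
      rcases lt_or_gt_of_ne hne with hlt | hlt
      · have hDx := h.derivative_ne_zero hd hD hlt hc
        have hDy : (derivative (q.map φ)).eval y ≠ 0 := fun h0 => hDx <| by
          have := h.sign_eq_left hd hc
          rwa [← derivative_map, h0, sign_zero, sign_eq_zero_iff] at this
        obtain ⟨h1, h2⟩ := h.strictMono hd hlt hc
        rw [hqx, hs.resolve_left hDy] at h1 h2
        rcases lt_or_gt_of_ne hDx with h0 | h0
        · exact lt_irrefl _ (h2 h0)
        · exact lt_irrefl _ (h1 h0)
      · have hDy := h.derivative_ne_zero hd hD hlt hc.symm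
        obtain ⟨h1, h2⟩ := h.strictMono hd hlt hc.symm
        rw [hqx, hs.resolve_left hDy] at h1 h2
        rcases lt_or_gt_of_ne hDy with h0 | h0
        · exact lt_irrefl _ (h2 h0)
        · exact lt_irrefl _ (h1 h0)
    · exact h.left.single x y ⟨q, hq, hq0, hqx⟩ hc

theorem Compat.range_refineLabel_subset (h : Compat S φ ψ c c') {p : R[X]}
    (hd : derivative p ∈ S) (hD : derivative (p.map φ) ≠ 0)
    (hlc : SignType.sign (p.map φ).leadingCoeff = SignType.sign (p.map ψ).leadingCoeff)
    (hdeg : (p.map φ).natDegree = (p.map ψ).natDegree)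
    (hroot : ∀ x ∈ zeros S φ, ∀ y, c x = c' y →
      SignType.sign ((p.map φ).eval x) = SignType.sign ((p.map ψ).eval y)) :
    range (refineLabel c (p.map φ)) ⊆ range (refineLabel c' (p.map ψ)) := by
  rintro _ ⟨x, rfl⟩
  have hder : ∀ {y}, c x = c' y → SignType.sign ((derivative (p.map φ)).eval x)
      = SignType.sign ((derivative (p.map ψ)).eval y) := fun {y} hxy => by
    have := h.sign_eq _ hd x y hxy
    rwa [← derivative_map, ← derivative_map] at this
  by_cases hx : x ∈ zeros S φ
  · obtain ⟨y, hy⟩ := h.exists_right x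
    exact ⟨y, (refineLabel_eq_iff.2 ⟨hy, by rw [hroot x hx y hy, hder hy]⟩).symm⟩
  have hDx : (derivative (p.map φ)).eval x ≠ 0 := fun h0 =>
    hx ⟨_, hd, by rwa [← derivative_map], by rwa [← derivative_map]⟩
  have hcorr : ∀ z w, c z = c' w → (z ∈ zeros S φ ↔ w ∈ zeros S ψ) := fun z w hzw =>
    ⟨h.mem_zeros hzw, h.symm.mem_zeros hzw.symm⟩
  have hsD : ∀ u, c u = c x → SignType.sign ((derivative (p.map φ)).eval u)
      = SignType.sign ((derivative (p.map φ)).eval x) := fun u hu => by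
    have := h.sign_eq_left hd hu
    rwa [← derivative_map] at this
  obtain ⟨y, hy, hs⟩ : ∃ y, c' y = c x ∧
      SignType.sign ((p.map φ).eval x) = SignType.sign ((p.map ψ).eval y) := by
    rcases lt_or_gt_of_ne hDx with h0 | h0
    · obtain ⟨y, hy, hs⟩ := exists_sign_eq h.left h.right h.range_eq hcorr (-(p.map φ))
        (-(p.map ψ)) (fun z hz w hzw => by simp [Left.sign_neg, hroot z hz w hzw])
        (by simp [Left.sign_neg, hlc]) (by simpa using hdeg) hx (fun u v hu hv huv => by
          have := (h.strictMono hd huv (hu.trans hv.symm)).2 (by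
            have := hsD u hu
            rwa [sign_neg h0, sign_eq_neg_one_iff] at this)
          simpa using this)
      exact ⟨y, hy, by simpa [Left.sign_neg] using hs⟩
    · exact exists_sign_eq h.left h.right h.range_eq hcorr (p.map φ)
        (p.map ψ) hroot hlc hdeg hx (fun u v hu hv huv =>
          (h.strictMono hd huv (hu.trans hv.symm)).1 (by
            have := hsD u hu
            rwa [sign_pos h0, sign_eq_one_iff] at this))
  exact ⟨y, (refineLabel_eq_iff.2 ⟨hy.symm, by rw [hs, hder hy.symm]⟩).symm⟩

theorem Compat.insert (h : Compat S φ ψ c c') {p : R[X]}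
    (hd : derivative p ∈ S) (hD : derivative (p.map φ) ≠ 0)
    (hlc : SignType.sign (p.map φ).leadingCoeff = SignType.sign (p.map ψ).leadingCoeff)
    (hdeg : (p.map φ).natDegree = (p.map ψ).natDegree)
    (hroot : ∀ x ∈ zeros S φ, ∀ y, c x = c' y →
      SignType.sign ((p.map φ).eval x) = SignType.sign ((p.map ψ).eval y)) :
    Compat (insert p S) φ ψ (refineLabel c (p.map φ)) (refineLabel c' (p.map ψ)) := by
  have hD' : derivative (p.map ψ) ≠ 0 := fun h0 => hD <| by
    have := h.map_eq_zero hd (by rwa [← derivative_map])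
    rwa [← derivative_map] at this
  refine ⟨h.cells_refineLabel hd hD, h.symm.cells_refineLabel hd hD',
    (h.range_refineLabel_subset hd hD hlc hdeg hroot).antisymm
      (h.symm.range_refineLabel_subset hd hD' hlc.symm hdeg.symm
        fun y hy x hxy => (hroot x (h.symm.mem_zeros hxy hy) y hxy.symm).symm), ?_⟩
  rintro q hq x y hxy
  obtain ⟨hc, hs⟩ := refineLabel_eq_iff.1 hxy
  rcases mem_insert_iff.1 hq with rfl | hq
  · by_cases hx : x ∈ zeros S φ
    · exact hroot x hx y hc
    have hDx : (derivative (q.map φ)).eval x ≠ 0 := fun h0 =>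
      hx ⟨_, hd, by rwa [← derivative_map], by rwa [← derivative_map]⟩
    have hder := h.sign_eq _ hd x y hc
    rw [← derivative_map, ← derivative_map] at hder
    rw [← hder] at hs
    exact mul_left_cancel₀ (sign_ne_zero.2 hDx) hs
  · exact h.sign_eq q hq x y hc

end

section

open Filter Topology Set Polynomial

variable {R : Type*} [CommRing R] {S : Set R[X]} {φ ψ : R →+* ℝ}

theorem exists_pseudo_remainder (b : R[X]) (hb : 0 < b.natDegree) (a : R[X]) :
    ∃ r : R[X], r.natDegree < b.natDegree ∧
      ∃ (k : ℕ) (m : R[X]), C b.leadingCoeff ^ k * a = m * b + r := by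
  induction hn : a.natDegree using Nat.strong_induction_on generalizing a with
  | _ n ih =>
    subst hn
    rcases lt_or_ge a.natDegree b.natDegree with hlt | hge
    · exact ⟨a, hlt, 0, 0, by simp⟩
    set a' := C b.leadingCoeff * a - C a.leadingCoeff * X ^ (a.natDegree - b.natDegree) * b
    have hdeg : a'.natDegree < a.natDegree := by
      have hle : a'.natDegree ≤ a.natDegree := by
        refine (natDegree_sub_le _ _).trans (max_le (natDegree_C_mul_le _ _) ?_)
        refine natDegree_mul_le.trans ?_
        have := natDegree_C_mul_X_pow_le a.leadingCoeff (a.natDegree - b.natDegree)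
        omega
      refine lt_of_le_of_ne hle fun heq => ?_
      have hc : a'.coeff a.natDegree = 0 := by
        have : a.natDegree = b.natDegree + (a.natDegree - b.natDegree) := by omega
        rw [coeff_sub, coeff_C_mul, mul_assoc, coeff_C_mul, coeff_X_pow_mul']
        rw [if_pos (Nat.sub_le _ _), show a.natDegree - (a.natDegree - b.natDegree) = b.natDegree
          by omega, coeff_natDegree, coeff_natDegree, mul_comm, sub_self]
      rw [← heq, coeff_natDegree, leadingCoeff_eq_zero] at hc
      rw [hc, natDegree_zero] at heq
      omega
    obtain ⟨r, hr, k, m, hm⟩ := ih _ hdeg a' rfl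
    refine ⟨r, hr, k + 1,
      m + C b.leadingCoeff ^ k * (C a.leadingCoeff * X ^ (a.natDegree - b.natDegree)), ?_⟩
    have : C b.leadingCoeff ^ k * (C b.leadingCoeff * a) = C b.leadingCoeff ^ k * a'
      + C b.leadingCoeff ^ k * (C a.leadingCoeff * X ^ (a.natDegree - b.natDegree)) * b := by
      simp only [a']; ring
    rw [pow_succ, mul_assoc, this, hm]
    ring

/-- `S` is stable under the operations that determine its members of degree `> k`: derivatives,
leading terms and pseudo-remainders. -/
def ClosedAbove (S : Set R[X]) (k : ℕ) : Prop :=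
  ∀ a ∈ S, k < a.natDegree → derivative a ∈ S ∧ a.eraseLead ∈ S ∧ C a.leadingCoeff ∈ S ∧
    ∀ b ∈ S, k < b.natDegree → b.natDegree ≤ a.natDegree →
      ∃ r ∈ S, r.natDegree < b.natDegree ∧
        ∃ (l : ℕ) (m : R[X]), C b.leadingCoeff ^ l * a = m * b + r

theorem ClosedAbove.exists_superset {k : ℕ} (hS : S.Finite) (h : ClosedAbove S (k + 1)) :
    ∃ T : Set R[X], T.Finite ∧ S ⊆ T ∧ ClosedAbove T k := by
  have hex : ∀ b a : R[X], ∃ r : R[X], 0 < b.natDegree → (r.natDegree < b.natDegree ∧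
      ∃ (k : ℕ) (m : R[X]), C b.leadingCoeff ^ k * a = m * b + r) := fun b a => by
    by_cases hb : 0 < b.natDegree
    · obtain ⟨r, hr⟩ := exists_pseudo_remainder b hb a
      exact ⟨r, fun _ => hr⟩
    · exact ⟨0, fun h => absurd h hb⟩
  choose rem hrem using hex
  let L : Set R[X] := {a ∈ S | a.natDegree = k + 1}
  have hL : L.Finite := hS.subset (sep_subset _ _)
  let T := S ∪ (derivative '' L ∪ eraseLead '' L ∪ (fun a => C a.leadingCoeff) '' L
    ∪ image2 rem L S)
  have hT : ∀ a ∈ T, k < a.natDegree → a ∈ S := by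
    rintro a (ha | ((⟨b, hb, rfl⟩ | ⟨b, hb, rfl⟩) | ⟨b, hb, rfl⟩) | ⟨b, hb, c, hc, rfl⟩) hk
    · exact ha
    · have := natDegree_derivative_le b
      have := hb.2
      omega
    · have := eraseLead_natDegree_le b
      have := hb.2
      omega
    · simp at hk
    · have := (hrem b c (by have := hb.2; omega)).1
      have := hb.2
      omega
  refine ⟨T, hS.union (((((hL.image _).union (hL.image _)).union (hL.image _))).union
    (hL.image2 _ hS)), subset_union_left, fun a ha hk => ?_⟩
  have haS := hT a ha hk
  have hrem' : ∀ b ∈ T, k < b.natDegree → b.natDegree ≤ a.natDegree →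
      ∃ r ∈ T, r.natDegree < b.natDegree ∧
        ∃ (l : ℕ) (m : R[X]), C b.leadingCoeff ^ l * a = m * b + r := by
    intro b hb hkb hba
    have hbS := hT b hb hkb
    by_cases hb1 : b.natDegree = k + 1
    · exact ⟨rem b a, Or.inr (Or.inr ⟨b, ⟨hbS, hb1⟩, a, haS, rfl⟩), hrem b a (by omega)⟩
    · obtain ⟨r, hr, hr'⟩ := (h a haS (by omega)).2.2.2 b hbS (by omega) hba
      exact ⟨r, Or.inl hr, hr'⟩
  by_cases ha1 : a.natDegree = k + 1
  · exact ⟨Or.inr (Or.inl (Or.inl (Or.inl ⟨a, ⟨haS, ha1⟩, rfl⟩))),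
      Or.inr (Or.inl (Or.inl (Or.inr ⟨a, ⟨haS, ha1⟩, rfl⟩))),
      Or.inr (Or.inl (Or.inr ⟨a, ⟨haS, ha1⟩, rfl⟩)), hrem'⟩
  · obtain ⟨h1, h2, h3, -⟩ := h a haS (by omega)
    exact ⟨Or.inl h1, Or.inl h2, Or.inl h3, hrem'⟩

theorem exists_closedAbove (hS : S.Finite) :
    ∃ T : Set R[X], T.Finite ∧ S ⊆ T ∧ ClosedAbove T 0 := by
  obtain ⟨d, hd⟩ : ∃ d, ∀ a ∈ S, a.natDegree ≤ d := by
    obtain ⟨d, hd⟩ := (hS.image natDegree).bddAbove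
    exact ⟨d, fun a ha => hd ⟨a, ha, rfl⟩⟩
  have key : ∀ k S, S.Finite → ClosedAbove (R := R) S k →
      ∃ T : Set R[X], T.Finite ∧ S ⊆ T ∧ ClosedAbove T 0 := by
    intro k
    induction k with
    | zero => exact fun S hS h => ⟨S, hS, Subset.rfl, h⟩
    | succ k ih =>
      intro S hS h
      obtain ⟨T, hT, hST, hcl⟩ := h.exists_superset hS
      obtain ⟨T', hT', hTT', hcl'⟩ := ih T hT hcl
      exact ⟨T', hT', hST.trans hTT', hcl'⟩
  exact key d S hS fun a ha hda => absurd (hd a ha) (not_le.2 hda)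

theorem map_eraseLead_eq_map {p : R[X]} (h : φ p.leadingCoeff = 0) :
    p.eraseLead.map φ = p.map φ := by
  have := congrArg (Polynomial.map φ) (eraseLead_add_C_mul_X_pow p)
  rw [Polynomial.map_add, Polynomial.map_mul, map_C, h, C_0, zero_mul, add_zero] at this
  exact this

theorem exists_root_leadingCoeff_ne_zero {q : R[X]} (hq : q ∈ S) (h0 : q.map φ ≠ 0) {x : ℝ}
    (hx : (q.map φ).eval x = 0) (hS : ∀ q ∈ S, 0 < q.natDegree → q.eraseLead ∈ S) :
    ∃ q ∈ S, 0 < q.natDegree ∧ φ q.leadingCoeff ≠ 0 ∧ (q.map φ).eval x = 0 := by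
  induction hn : q.natDegree using Nat.strong_induction_on generalizing q with
  | _ n ih =>
    subst hn
    have hdeg : 0 < q.natDegree := by
      by_contra hle
      rw [eq_C_of_natDegree_eq_zero (by omega : q.natDegree = 0)] at hx h0
      simp at hx
      simp [hx] at h0
    by_cases hlc : φ q.leadingCoeff = 0
    · have he := map_eraseLead_eq_map hlc
      exact ih _ (by have := eraseLead_natDegree_le q; omega) (hS q hq hdeg) (he ▸ h0)
        (he ▸ hx) rfl
    · exact ⟨q, hq, hdeg, hlc, hx⟩

theorem Compat.insert_of_map_eq {J : Type*} [LinearOrder J] {c c' : ℝ → J}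
    (h : Compat S φ ψ c c') {p e : R[X]} (he : e ∈ S) (h1 : e.map φ = p.map φ)
    (h2 : e.map ψ = p.map ψ) : Compat (Insert.insert p S) φ ψ c c' := by
  have hz : ∀ {φ : R →+* ℝ}, e.map φ = p.map φ → zeros (Insert.insert p S) φ = zeros S φ := by
    intro φ h1
    ext x
    constructor
    · rintro ⟨q, rfl | hq, hh⟩
      · exact ⟨e, he, h1 ▸ hh⟩
      · exact ⟨q, hq, hh⟩
    · rintro ⟨q, hq, hh⟩
      exact ⟨q, mem_insert_of_mem _ hq, hh⟩
  refine ⟨(hz h1).symm ▸ h.left, (hz h2).symm ▸ h.right, h.range_eq, ?_⟩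
  rintro q (rfl | hq) x y hxy
  · rw [← h1, ← h2]
    exact h.sign_eq e he x y hxy
  · exact h.sign_eq q hq x y hxy

theorem exists_compat_of_closed {T : Set R[X]} (hT : T.Finite) (hcl : ClosedAbove T 0)
    (hφψ : ∀ a, C a ∈ T → SignType.sign (φ a) = SignType.sign (ψ a)) (d : ℕ) :
    ∃ (J : Type) (_ : LinearOrder J) (c c' : ℝ → J),
      Compat {q ∈ T | q.natDegree ≤ d} φ ψ c c' := by
  induction d with
  | zero =>
    have hz : ∀ φ : R →+* ℝ, zeros {q ∈ T | q.natDegree ≤ 0} φ = ∅ := fun φ => by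
      ext x
      simp only [mem_empty_iff_false, iff_false]
      rintro ⟨q, ⟨-, hq⟩, h0, hx⟩
      rw [eq_C_of_natDegree_le_zero hq] at h0 hx
      simp at hx
      simp [hx] at h0
    have hc : ∀ φ : R →+* ℝ, Cells (fun _ => ()) (zeros {q ∈ T | q.natDegree ≤ 0} φ) := fun φ =>
      ⟨fun _ _ _ => le_rfl, fun _ _ => by simp,
        fun x y hx => absurd hx (by rw [hz]; exact notMem_empty x)⟩
    refine ⟨Unit, inferInstance, fun _ => (), fun _ => (), hc φ, hc ψ, rfl, ?_⟩
    rintro q ⟨hqT, hq⟩ x y -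
    rw [eq_C_of_natDegree_le_zero hq] at hqT ⊢
    simpa using hφψ _ hqT
  | succ d ih =>
    have key : ∀ A ⊆ {q ∈ T | q.natDegree = d + 1}, A.Finite →
        ∃ (J : Type) (_ : LinearOrder J) (c c' : ℝ → J),
          Compat (A ∪ {q ∈ T | q.natDegree ≤ d}) φ ψ c c' := by
      intro A hA hfin
      induction A, hfin using Set.Finite.induction_on with
      | empty => simpa using ih
      | @insert p A hpA hfin ihA =>
        obtain ⟨J, _, c, c', hc⟩ := ihA ((subset_insert p A).trans hA)
        obtain ⟨hpT, hpd⟩ := hA (mem_insert p A)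
        obtain ⟨h1, h2, h3, h4⟩ := hcl p hpT (by omega)
        rw [insert_union]
        have hmem : ∀ q ∈ T, q.natDegree ≤ d → q ∈ A ∪ {q ∈ T | q.natDegree ≤ d} :=
          fun q hq hqd => Or.inr ⟨hq, hqd⟩
        have hsub : ∀ q ∈ A ∪ {q ∈ T | q.natDegree ≤ d}, q ∈ T ∧ q.natDegree ≤ d + 1 := by
          rintro q (hq | hq)
          · have := hA (mem_insert_of_mem p hq)
            exact ⟨this.1, this.2.le⟩
          · exact ⟨hq.1, hq.2.trans (Nat.le_succ d)⟩
        have hsgn : ∀ a, C a ∈ T → (φ a = 0 ↔ ψ a = 0) := fun a ha => by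
          rw [← sign_eq_zero_iff, hφψ a ha, sign_eq_zero_iff]
        by_cases hlc : φ p.leadingCoeff = 0
        · exact ⟨J, _, c, c', hc.insert_of_map_eq
            (hmem _ h2 (by have := eraseLead_natDegree_le p; omega)) (map_eraseLead_eq_map hlc)
            (map_eraseLead_eq_map ((hsgn _ h3).1 hlc))⟩
        have hlc' : ψ p.leadingCoeff ≠ 0 := fun hh => hlc ((hsgn _ h3).2 hh)
        refine ⟨_, _, _, _, hc.insert (p := p)
          (hmem _ h1 (by have := natDegree_derivative_le p; omega)) ?_ ?_ ?_ ?_⟩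
        · intro h0
          have := derivative_eq_zero.1 h0
          rw [natDegree_map_of_leadingCoeff_ne_zero φ hlc] at this
          omega
        · rw [leadingCoeff_map_of_leadingCoeff_ne_zero φ hlc,
            leadingCoeff_map_of_leadingCoeff_ne_zero ψ hlc', hφψ _ h3]
        · rw [natDegree_map_of_leadingCoeff_ne_zero φ hlc,
            natDegree_map_of_leadingCoeff_ne_zero ψ hlc']
        · rintro x ⟨q, hq, hq0, hqx⟩ y hxy
          obtain ⟨q, hq, hq0, hqlc, hqx⟩ := exists_root_leadingCoeff_ne_zero hq hq0 hqx
            fun q hq hq0 => hmem _ (hcl q (hsub q hq).1 hq0).2.1 (by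
              have := (hsub q hq).2
              have := eraseLead_natDegree_le q
              omega)
          have hqT := hsub q hq
          obtain ⟨r, hrT, hrd, l, m, hm⟩ := h4 q hqT.1 hq0 (by omega)
          have hqy : (q.map ψ).eval y = 0 := by
            have := hc.sign_eq q hq x y hxy
            rwa [hqx, sign_zero, eq_comm, sign_eq_zero_iff] at this
          have hr := hc.sign_eq r (hmem r hrT (by omega)) x y hxy
          have e1 := congrArg (fun u => SignType.sign ((u.map φ).eval x)) hm
          have e2 := congrArg (fun u => SignType.sign ((u.map ψ).eval y)) hm
          have hqC := (hcl q hqT.1 hq0).2.2.1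
          simp only [Polynomial.map_add, Polynomial.map_mul, Polynomial.map_pow, map_C, eval_add,
            eval_mul, eval_pow, eval_C, hqx, hqy, mul_zero, zero_add, sign_mul, sign_pow] at e1 e2
          rw [← hr, ← e1, hφψ _ hqC] at e2
          have hne : SignType.sign (ψ q.leadingCoeff) ^ l ≠ 0 := by
            refine pow_ne_zero _ ?_
            rw [← hφψ _ hqC]
            exact sign_ne_zero.2 hqlc
          exact (mul_left_cancel₀ hne e2).symm
    obtain ⟨J, _, c, c', hc⟩ := key _ Subset.rfl (hT.subset (sep_subset _ _))
    have hset : {q ∈ T | q.natDegree ≤ d + 1} =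
        {q ∈ T | q.natDegree = d + 1} ∪ {q ∈ T | q.natDegree ≤ d} := by
      ext q
      simp only [mem_ofPred_eq, mem_union, ← and_or_left]
      exact and_congr_right fun _ => by omega
    rw [hset]
    exact ⟨J, _, c, c', hc⟩

/-- Elimination of one real variable: the sign vectors which finitely many polynomials with
coefficients in `R` take on the line over a point `φ` only depend on the signs of finitely many
elements of `R` at `φ`. -/
theorem exists_finite_sign_determined (hS : S.Finite) :
    ∃ H : Set R, H.Finite ∧ ∀ φ ψ : R →+* ℝ,
      (∀ a ∈ H, SignType.sign (φ a) = SignType.sign (ψ a)) → ∀ x : ℝ, ∃ y : ℝ, ∀ p ∈ S,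
        SignType.sign ((p.map φ).eval x) = SignType.sign ((p.map ψ).eval y) := by
  obtain ⟨T, hT, hST, hcl⟩ := exists_closedAbove hS
  refine ⟨C ⁻¹' T, hT.preimage (C_injective.injOn), fun φ ψ h x => ?_⟩
  obtain ⟨d, hd⟩ : ∃ d, ∀ a ∈ T, a.natDegree ≤ d := by
    obtain ⟨d, hd⟩ := (hT.image natDegree).bddAbove
    exact ⟨d, fun a ha => hd ⟨a, ha, rfl⟩⟩
  obtain ⟨J, _, c, c', hc⟩ := exists_compat_of_closed hT hcl h d
  obtain ⟨y, hy⟩ := hc.exists_right x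
  exact ⟨y, fun p hp => hc.sign_eq p ⟨hST hp, hd p (hST hp)⟩ x y hy⟩

end

section

open Filter Topology Set

theorem comp_list_prod {ι V V' : Type*} [NormedAddCommGroup V] [NormedSpace ℝ V]
    [NormedAddCommGroup V'] [NormedSpace ℝ V'] (T : V →L[ℝ] V')
    {x : ι → (V →L[ℝ] V)} {x' : ι → (V' →L[ℝ] V')} (h : ∀ i, T ∘L x i = x' i ∘L T) (l : List ι) :
    T ∘L (l.map x).prod = (l.map x').prod ∘L T := by
  induction l with
  | nil => ext; simp
  | cons i l ih =>
    ext v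
    have h1 := congrArg (fun f => f v) ih
    have h2 := congrArg (fun f => f ((l.map x).prod v)) (h i)
    simp only [ContinuousLinearMap.comp_apply] at h1 h2
    simp [h1, h2]

section FunctionalCalculus

variable {ι : Type*} [Fintype ι] [DecidableEq ι]
  (𝔸 : Type*) [NormedRing 𝔸] [NormedAlgebra ℝ 𝔸]

/-- The power series which evaluates the noncommutative polynomials underlying `p` in `𝔸`. -/
noncomputable def liftSeries (p : FormalMultilinearSeries ℝ (ι → ℝ) ℝ) :
    FormalMultilinearSeries ℝ (ι → 𝔸) 𝔸 := fun k =>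
  ∑ I : Fin k → ι, p k (fun j => Pi.single (I j) 1) •
    (ContinuousMultilinearMap.mkPiAlgebraFin ℝ k 𝔸).compContinuousLinearMap
      (fun j => ContinuousLinearMap.proj (R := ℝ) (φ := fun _ : ι => 𝔸) (I j))

variable {𝔸}

theorem liftSeries_apply (p : FormalMultilinearSeries ℝ (ι → ℝ) ℝ) (k : ℕ) (x : ι → 𝔸) :
    liftSeries 𝔸 p k (fun _ => x) = ∑ I : Fin k → ι, p k (fun j => Pi.single (I j) 1) •
      (List.ofFn fun j => x (I j)).prod := by
  simp [liftSeries]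

theorem norm_liftSeries_le (p : FormalMultilinearSeries ℝ (ι → ℝ) ℝ) (k : ℕ) :
    ‖liftSeries 𝔸 p k‖ ≤ (Fintype.card ι : ℝ) ^ k * (‖p k‖ * max 1 ‖(1 : 𝔸)‖) := by
  refine ContinuousMultilinearMap.opNorm_le_bound (by positivity) fun x => ?_
  have hb : ∀ I : Fin k → ι, ‖p k (fun j => Pi.single (I j) 1) •
      ContinuousMultilinearMap.mkPiAlgebraFin ℝ k 𝔸 (fun j => x j (I j))‖ ≤
      ‖p k‖ * max 1 ‖(1 : 𝔸)‖ * ∏ j, ‖x j‖ := by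
    intro I
    rw [norm_smul, mul_assoc]
    refine mul_le_mul ?_ ?_ (norm_nonneg _) (norm_nonneg _)
    · refine ((p k).le_opNorm _).trans ?_
      simp [Pi.norm_single]
    · refine (ContinuousMultilinearMap.le_opNorm _ _).trans ?_
      refine mul_le_mul ContinuousMultilinearMap.norm_mkPiAlgebraFin_le ?_ (by positivity)
        (by positivity)
      exact Finset.prod_le_prod (fun _ _ => norm_nonneg _) fun j _ => norm_le_pi_norm (x j) (I j)
  have := norm_sum_le_of_le Finset.univ fun I _ => hb I
  simpa [liftSeries, mul_assoc] using this

theorem liftSeries_radius_pos {p : FormalMultilinearSeries ℝ (ι → ℝ) ℝ} (hp : 0 < p.radius) :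
    0 < (liftSeries 𝔸 p).radius := by
  obtain ⟨r, hr0, hr⟩ := ENNReal.lt_iff_exists_nnreal_btwn.1 hp
  obtain ⟨C, hC, hb⟩ := p.norm_mul_pow_le_of_lt_radius hr
  have hr0' : 0 < r := by exact_mod_cast hr0
  let s : NNReal := r / (Fintype.card ι + 1)
  have hs : 0 < s := by positivity
  refine lt_of_lt_of_le (ENNReal.coe_pos.2 hs)
    ((liftSeries 𝔸 p).le_radius_of_bound (C * max 1 ‖(1 : 𝔸)‖) fun k => ?_)
  have hc : (Fintype.card ι : ℝ) * s ≤ r := by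
    simp only [s, NNReal.coe_div, NNReal.coe_add, NNReal.coe_natCast, NNReal.coe_one]
    rw [mul_div_assoc', div_le_iff₀ (by positivity)]
    nlinarith [r.coe_nonneg]
  calc ‖liftSeries 𝔸 p k‖ * (s : ℝ) ^ k
      ≤ (Fintype.card ι : ℝ) ^ k * (‖p k‖ * max 1 ‖(1 : 𝔸)‖) * (s : ℝ) ^ k := by
        gcongr; exact norm_liftSeries_le p k
    _ = ‖p k‖ * ((Fintype.card ι : ℝ) * s) ^ k * max 1 ‖(1 : 𝔸)‖ := by rw [mul_pow]; ring
    _ ≤ ‖p k‖ * (r : ℝ) ^ k * max 1 ‖(1 : 𝔸)‖ := by gcongr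
    _ ≤ C * max 1 ‖(1 : 𝔸)‖ := by gcongr; exact hb k

variable {V V' : Type*} [NormedAddCommGroup V] [NormedSpace ℝ V] [CompleteSpace V]
  [NormedAddCommGroup V'] [NormedSpace ℝ V'] [CompleteSpace V']

theorem liftSeries_sum_comp {p : FormalMultilinearSeries ℝ (ι → ℝ) ℝ} (T : V →L[ℝ] V')
    {x : ι → (V →L[ℝ] V)} {x' : ι → (V' →L[ℝ] V')} (h : ∀ i, T ∘L x i = x' i ∘L T)
    (hx : x ∈ Metric.eball 0 (liftSeries (V →L[ℝ] V) p).radius)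
    (hx' : x' ∈ Metric.eball 0 (liftSeries (V' →L[ℝ] V') p).radius) :
    T ∘L (liftSeries (V →L[ℝ] V) p).sum x = (liftSeries (V' →L[ℝ] V') p).sum x' ∘L T := by
  have h1 := ((liftSeries (V →L[ℝ] V) p).hasSum hx).mapL
    (ContinuousLinearMap.compL ℝ V V V' T)
  have h2 := ((liftSeries (V' →L[ℝ] V') p).hasSum hx').mapL
    ((ContinuousLinearMap.compL ℝ V V' V').flip T)
  refine (h1.unique ?_)
  refine h2.congr_fun fun k => ?_
  rw [liftSeries_apply, liftSeries_apply, map_sum, map_sum]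
  refine Finset.sum_congr rfl fun I _ => ?_
  rw [map_smul, map_smul]
  congr 1
  have := comp_list_prod T h (List.ofFn I)
  simpa [List.map_ofFn, Function.comp_def] using this

theorem liftSeries_sum_smul_one {p : FormalMultilinearSeries ℝ (ι → ℝ) ℝ} {h : (ι → ℝ) → ℝ}
    {r : ENNReal} (hp : HasFPowerSeriesOnBall h p 0 r) {c : ι → ℝ} (hc : c ∈ Metric.eball 0 r) :
    (liftSeries 𝔸 p).sum (fun i => c i • (1 : 𝔸)) = h c • (1 : 𝔸) := by
  have h1 := (hp.hasSum hc).mapL ((1 : ℝ →L[ℝ] ℝ).smulRight (1 : 𝔸))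
  simp only [zero_add] at h1
  have h2 : HasSum (fun k => liftSeries 𝔸 p k fun _ => (fun i => c i • (1 : 𝔸)))
      (h c • (1 : 𝔸)) := by
    rw [ContinuousLinearMap.smulRight_apply] at h1
    refine h1.congr_fun fun k => ?_
    rw [liftSeries_apply]
    have e : (fun _ : Fin k => c) = fun _ => ∑ i, c i • Pi.single i (1 : ℝ) := by
      funext _ i
      simp [Finset.sum_apply, Pi.single_apply]
    rw [e, ContinuousMultilinearMap.map_sum]
    simp only [ContinuousMultilinearMap.map_smul_univ]
    simp only [map_sum]
    refine Finset.sum_congr rfl fun I _ => ?_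
    have : (List.ofFn fun j => c (I j) • (1 : 𝔸)).prod = (∏ j, c (I j)) • (1 : 𝔸) := by
      simp only [← Algebra.algebraMap_eq_smul_one]
      rw [← List.prod_ofFn, map_list_prod, List.map_ofFn]
      rfl
    rw [this]
    simp [smul_smul, mul_comm]
  exact h2.tsum_eq

end FunctionalCalculus

end

section

open Filter Topology Set

section Companion

variable {k : ℕ}

/-- The nilpotent shift of the standard basis. -/
noncomputable def shift (k : ℕ) : (Fin (k + 1) → ℝ) →L[ℝ] (Fin (k + 1) → ℝ) :=
  ContinuousLinearMap.pi (Fin.cases 0 fun j => ContinuousLinearMap.proj j.castSucc)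

/-- Multiplication by the variable modulo `t ^ (k + 1) + ∑ a j * t ^ j`, in the basis formed by
the powers of `t / δ`. -/
noncomputable def companion (δ : ℝ) (a : Fin (k + 1) → ℝ) :
    (Fin (k + 1) → ℝ) →L[ℝ] (Fin (k + 1) → ℝ) :=
  δ • shift k - (ContinuousLinearMap.proj (Fin.last k) : (Fin (k + 1) → ℝ) →L[ℝ] ℝ).smulRight
    (fun j => a j * (δ ^ (j : ℕ) / δ ^ k))

/-- The companion operator of `(X - t) * (X ^ (k + 1) + ∑ a j * X ^ j)`. -/
noncomputable def extCompanion (δ : ℝ) (a : Fin (k + 1) → ℝ) (t : ℝ) :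
    ((Fin (k + 1) → ℝ) × ℝ) →L[ℝ] ((Fin (k + 1) → ℝ) × ℝ) :=
  (companion δ a ∘L ContinuousLinearMap.fst ℝ _ _).prod
    (t • ContinuousLinearMap.snd ℝ _ _ +
      δ • (ContinuousLinearMap.proj (Fin.last k) ∘L ContinuousLinearMap.fst ℝ _ _))

/-- Evaluation at `t`, as an eigenvector of the transpose of `extCompanion δ a t`. -/
noncomputable def evalCovector (δ : ℝ) (a : Fin (k + 1) → ℝ) (t : ℝ) :
    ((Fin (k + 1) → ℝ) × ℝ) →L[ℝ] ℝ :=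
  (∑ j : Fin (k + 1), (t / δ) ^ (j : ℕ) • ContinuousLinearMap.proj j) ∘L
      ContinuousLinearMap.fst ℝ _ _ +
    ((t ^ (k + 1) + ∑ j, a j * t ^ (j : ℕ)) / δ ^ (k + 1)) • ContinuousLinearMap.snd ℝ _ _

theorem evalCovector_apply (δ : ℝ) (a : Fin (k + 1) → ℝ) (t : ℝ) (v : Fin (k + 1) → ℝ) (c : ℝ) :
    evalCovector δ a t (v, c) = ∑ j : Fin (k + 1), (t / δ) ^ (j : ℕ) * v j +
      ((t ^ (k + 1) + ∑ j, a j * t ^ (j : ℕ)) / δ ^ (k + 1)) * c := by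
  simp [evalCovector]

theorem evalCovector_comp_extCompanion {δ : ℝ} (hδ : δ ≠ 0) (a : Fin (k + 1) → ℝ) (t : ℝ) :
    evalCovector δ a t ∘L extCompanion δ a t =
      (t • (1 : ℝ →L[ℝ] ℝ)) ∘L evalCovector δ a t := by
  have key : ∀ v c, evalCovector δ a t (extCompanion δ a t (v, c)) =
      t * evalCovector δ a t (v, c) := by
    intro v c
    have h1 : extCompanion δ a t (v, c) = (companion δ a v, t * c + δ * v (Fin.last k)) := by
      simp [extCompanion]
    have h2 : ∑ j : Fin (k + 1), (t / δ) ^ (j : ℕ) * companion δ a v j =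
        t * ∑ j : Fin k, (t / δ) ^ (j : ℕ) * v j.castSucc -
          v (Fin.last k) / δ ^ k * ∑ j : Fin (k + 1), a j * t ^ (j : ℕ) := by
      have h3 : ∀ j, companion δ a v j =
          δ * shift k v j - v (Fin.last k) * (a j * (δ ^ (j : ℕ) / δ ^ k)) := fun j => by
        simp [companion]
      simp only [h3, mul_sub, Finset.sum_sub_distrib]
      congr 1
      · rw [Fin.sum_univ_succ, Finset.mul_sum]
        simp only [shift, ContinuousLinearMap.coe_pi', Fin.cases_zero, Fin.cases_succ,
          zero_apply, mul_zero, zero_add, Fin.val_succ,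
          ContinuousLinearMap.proj_apply]
        refine Finset.sum_congr rfl fun j _ => ?_
        rw [pow_succ]
        field_simp
      · rw [Finset.mul_sum]
        refine Finset.sum_congr rfl fun j _ => ?_
        rw [div_pow]
        field_simp
    rw [h1, evalCovector_apply, evalCovector_apply, h2, Fin.sum_univ_castSucc (n := k)]
    simp only [Fin.val_castSucc, Fin.val_last, mul_add, Fin.sum_univ_castSucc (n := k), div_pow]
    field_simp
    ring
  refine ContinuousLinearMap.ext fun v => ?_
  simpa using key v.1 v.2

theorem norm_extCompanion_zero_le {δ : ℝ} (hδ : 0 ≤ δ) :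
    ‖extCompanion δ (0 : Fin (k + 1) → ℝ) 0‖ ≤ δ := by
  refine ContinuousLinearMap.opNorm_le_bound _ hδ fun v => ?_
  have hs : ‖shift k v.1‖ ≤ ‖v‖ := by
    refine (pi_norm_le_iff_of_nonneg (norm_nonneg _)).2 fun j => ?_
    refine Fin.cases ?_ (fun j => ?_) j
    · simp [shift]
    · simpa [shift] using (norm_le_pi_norm v.1 j.castSucc).trans (norm_fst_le v)
  have hl : ‖v.1 (Fin.last k)‖ ≤ ‖v‖ := (norm_le_pi_norm v.1 _).trans (norm_fst_le v)
  have e : extCompanion δ (0 : Fin (k + 1) → ℝ) 0 v = (δ • shift k v.1, δ • v.1 (Fin.last k)) := by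
    ext <;> simp [extCompanion, companion]
  rw [e, Prod.norm_def, norm_smul, norm_smul, Real.norm_of_nonneg hδ]
  exact max_le (by gcongr) (by gcongr)

theorem analyticAt_extCompanion {E : Type*} [NormedAddCommGroup E] [NormedSpace ℝ E] (δ : ℝ)
    {a : E → Fin (k + 1) → ℝ} {t : E → ℝ} {x : E} (ha : AnalyticAt ℝ a x)
    (ht : AnalyticAt ℝ t x) : AnalyticAt ℝ (fun x => extCompanion δ (a x) (t x)) x := by
  let D : (Fin (k + 1) → ℝ) →L[ℝ] (Fin (k + 1) → ℝ) :=
    ContinuousLinearMap.pi fun j => (δ ^ (j : ℕ) / δ ^ k) • ContinuousLinearMap.proj j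
  let l : ((Fin (k + 1) → ℝ) × ℝ) →L[ℝ] ℝ :=
    ContinuousLinearMap.proj (Fin.last k) ∘L ContinuousLinearMap.fst ℝ _ _
  let A : (Fin (k + 1) → ℝ) →L[ℝ] (((Fin (k + 1) → ℝ) × ℝ) →L[ℝ] ((Fin (k + 1) → ℝ) × ℝ)) :=
    (ContinuousLinearMap.smulRightL ℝ _ _ l) ∘L (ContinuousLinearMap.inl ℝ _ _) ∘L D
  let B : ((Fin (k + 1) → ℝ) × ℝ) →L[ℝ] ((Fin (k + 1) → ℝ) × ℝ) :=
    (ContinuousLinearMap.snd ℝ _ ℝ).smulRight ((0, 1) : (Fin (k + 1) → ℝ) × ℝ)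
  have e : (fun x => extCompanion δ (a x) (t x)) =
      fun x => -A (a x) + t x • B + extCompanion δ 0 0 := by
    funext x
    refine ContinuousLinearMap.ext fun v => Prod.ext (funext fun j => ?_) ?_
    · simp [A, B, l, D, extCompanion, companion]
      ring
    · simp [A, B, l, D, extCompanion, companion]
  rw [e]
  exact (((A.analyticAt _).comp ha).neg.add (ht.smul analyticAt_const)).add analyticAt_const

theorem fst_comp_extCompanion (δ : ℝ) (a : Fin (k + 1) → ℝ) (t : ℝ) :
    ContinuousLinearMap.fst ℝ _ _ ∘L extCompanion δ a t =
      companion δ a ∘L ContinuousLinearMap.fst ℝ _ _ := by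
  simp [extCompanion]

theorem norm_companion_le (δ : ℝ) (a : Fin (k + 1) → ℝ) (t : ℝ) :
    ‖companion δ a‖ ≤ ‖extCompanion δ a t‖ := by
  refine ContinuousLinearMap.opNorm_le_bound _ (norm_nonneg _) fun v => ?_
  have := (norm_fst_le (extCompanion δ a t (v, 0))).trans
    ((extCompanion δ a t).le_opNorm (v, 0))
  simpa [extCompanion, Prod.norm_def] using this

end Companion

end

section

open Filter Topology Set

theorem cons_mem_eball {G : Type*} [SeminormedAddCommGroup G] {n : ℕ} {s : NNReal} {R : ENNReal}
    (hs : s ≤ R) (hs0 : 0 < s) {a : G} {u : Fin n → G} (ha : ‖a‖ < s) (hu : ∀ i, ‖u i‖ < s) :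
    (Fin.cons a u : Fin (n + 1) → G) ∈ Metric.eball 0 R := by
  rw [Metric.mem_eball, edist_zero_right]
  refine lt_of_lt_of_le ?_ hs
  have : ‖(Fin.cons a u : Fin (n + 1) → G)‖ < s :=
    (pi_norm_lt_iff (by exact_mod_cast hs0)).2 fun i => Fin.cases (by simpa) (by simpa) i
  rw [← ofReal_norm, ← ENNReal.ofReal_coe_nnreal]
  exact (ENNReal.ofReal_lt_ofReal_iff (by exact_mod_cast hs0)).2 this

theorem norm_smul_one_le {V : Type*} [NormedAddCommGroup V] [NormedSpace ℝ V] (c : ℝ) :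
    ‖c • (1 : V →L[ℝ] V)‖ ≤ ‖c‖ := by
  rw [norm_smul]
  exact mul_le_of_le_one_right (norm_nonneg _) ContinuousLinearMap.norm_id_le

/-- The point `(x, e₁, …, eₙ)` over the algebra of endomorphisms of `V`. -/
noncomputable def operatorPoint {n : ℕ} {V : Type*} [NormedAddCommGroup V] [NormedSpace ℝ V]
    (x : V →L[ℝ] V) (e : Fin n → ℝ) : Fin (n + 1) → (V →L[ℝ] V) :=
  Fin.cons x fun i => e i • 1

theorem operatorPoint_smul_one {n : ℕ} {V : Type*} [NormedAddCommGroup V] [NormedSpace ℝ V]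
    (t : ℝ) (e : Fin n → ℝ) :
    operatorPoint (t • 1 : V →L[ℝ] V) e =
      fun i => (Fin.cons t e : Fin (n + 1) → ℝ) i • 1 := by
  funext i
  refine Fin.cases ?_ (fun i => ?_) i <;> simp [operatorPoint]

theorem operatorPoint_mem_eball {n : ℕ} {V : Type*} [NormedAddCommGroup V] [NormedSpace ℝ V]
    {x : V →L[ℝ] V} {e : Fin n → ℝ} {s : NNReal} {R : ENNReal} (hs : s ≤ R) (hs0 : 0 < s)
    (hx : ‖x‖ < s) (he : ‖e‖ < s) : operatorPoint x e ∈ Metric.eball 0 R :=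
  cons_mem_eball hs hs0 hx fun i =>
    (norm_smul_one_le _).trans_lt ((norm_le_pi_norm e i).trans_lt he)

theorem comp_operatorPoint {n : ℕ} {V V' : Type*} [NormedAddCommGroup V] [NormedSpace ℝ V]
    [NormedAddCommGroup V'] [NormedSpace ℝ V'] {T : V →L[ℝ] V'} {x : V →L[ℝ] V}
    {x' : V' →L[ℝ] V'} (h : T ∘L x = x' ∘L T) (e : Fin n → ℝ) (i : Fin (n + 1)) :
    T ∘L operatorPoint x e i = operatorPoint x' e i ∘L T := by
  refine Fin.cases h (fun i => ?_) i
  ext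
  simp [operatorPoint]

theorem analyticAt_operatorPoint {n : ℕ} {V E : Type*} [NormedAddCommGroup V] [NormedSpace ℝ V]
    [NormedAddCommGroup E] [NormedSpace ℝ E] {x : E → V →L[ℝ] V} {e : E → Fin n → ℝ} {z : E}
    (hx : AnalyticAt ℝ x z) (he : AnalyticAt ℝ e z) :
    AnalyticAt ℝ (fun z => operatorPoint (x z) (e z)) z := by
  refine AnalyticAt.pi fun i => Fin.cases ?_ (fun i => ?_) i
  · exact hx
  · have : AnalyticAt ℝ (fun z => e z i) z :=
      ((ContinuousLinearMap.proj (R := ℝ) (φ := fun _ : Fin n => ℝ) i).analyticAt _).comp he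
    exact this.smul analyticAt_const

theorem evalCovector_liftSeries_sum {n k : ℕ} {h : (Fin (n + 1) → ℝ) → ℝ}
    {p : FormalMultilinearSeries ℝ (Fin (n + 1) → ℝ) ℝ} {r : ENNReal}
    (hp : HasFPowerSeriesOnBall h p 0 r) {s : NNReal} (hs0 : 0 < s)
    (hs1 : s ≤ (liftSeries (((Fin (k + 1) → ℝ) × ℝ) →L[ℝ] ((Fin (k + 1) → ℝ) × ℝ)) p).radius)
    (hs3 : s ≤ (liftSeries (ℝ →L[ℝ] ℝ) p).radius) (hs4 : s ≤ r) {δ : ℝ} (hδ : δ ≠ 0)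
    {a : Fin (k + 1) → ℝ} {t : ℝ} {e : Fin n → ℝ} (hN : ‖extCompanion δ a t‖ < s)
    (he : ‖e‖ < s) (ht : ‖t‖ < s) :
    evalCovector δ a t ((liftSeries _ p).sum (operatorPoint (extCompanion δ a t) e)
      (Pi.single 0 1, 0)) = h (Fin.cons t e) := by
  have := liftSeries_sum_comp (p := p) (evalCovector δ a t)
    (comp_operatorPoint (evalCovector_comp_extCompanion hδ a t) e)
    (operatorPoint_mem_eball hs1 hs0 hN he)
    (operatorPoint_mem_eball hs3 hs0 ((norm_smul_one_le _).trans_lt ht) he)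
  rw [operatorPoint_smul_one, liftSeries_sum_smul_one hp
    (cons_mem_eball hs4 hs0 ht fun i => (norm_le_pi_norm e i).trans_lt he)] at this
  have h4 := congrArg (fun f => f (Pi.single 0 1, 0)) this
  have h5 : evalCovector δ a t (Pi.single 0 1, 0) = 1 := by
    simp [evalCovector_apply, Pi.single_apply]
  simpa [h5] using h4

theorem fst_liftSeries_sum {n k : ℕ} {p : FormalMultilinearSeries ℝ (Fin (n + 1) → ℝ) ℝ}
    {s : NNReal} (hs0 : 0 < s)
    (hs1 : s ≤ (liftSeries (((Fin (k + 1) → ℝ) × ℝ) →L[ℝ] ((Fin (k + 1) → ℝ) × ℝ)) p).radius)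
    (hs2 : s ≤ (liftSeries ((Fin (k + 1) → ℝ) →L[ℝ] (Fin (k + 1) → ℝ)) p).radius) {δ : ℝ}
    {a : Fin (k + 1) → ℝ} {t : ℝ} {e : Fin n → ℝ} (hN : ‖extCompanion δ a t‖ < s)
    (he : ‖e‖ < s) (v : (Fin (k + 1) → ℝ) × ℝ) :
    ((liftSeries _ p).sum (operatorPoint (extCompanion δ a t) e) v).1 =
      (liftSeries _ p).sum (operatorPoint (companion δ a) e) v.1 :=
  congrArg (fun f => f v) (liftSeries_sum_comp (p := p) (ContinuousLinearMap.fst ℝ _ ℝ)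
    (comp_operatorPoint (fst_comp_extCompanion δ a t) e) (operatorPoint_mem_eball hs1 hs0 hN he)
    (operatorPoint_mem_eball hs2 hs0 ((norm_companion_le δ a t).trans_lt hN) he))

/-- Division of an analytic germ by the generic monic polynomial of degree `k + 1`. -/
theorem exists_generic_division {n : ℕ} {h : (Fin (n + 1) → ℝ) → ℝ} (hh : AnalyticAt ℝ h 0)
    (k : ℕ) :
    ∃ (R : (Fin n → ℝ) × (Fin (k + 1) → ℝ) → (Fin (k + 1) → ℝ))
      (q : ((Fin n → ℝ) × (Fin (k + 1) → ℝ)) × ℝ → ℝ), AnalyticAt ℝ R 0 ∧ AnalyticAt ℝ q 0 ∧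
      ∀ᶠ y : ((Fin n → ℝ) × (Fin (k + 1) → ℝ)) × ℝ in 𝓝 0, h (Fin.cons y.2 y.1.1) =
        q y * (y.2 ^ (k + 1) + ∑ j, y.1.2 j * y.2 ^ (j : ℕ)) + ∑ j, R y.1 j * y.2 ^ (j : ℕ) := by
  obtain ⟨p, r, hp⟩ := hh
  have hr : 0 < p.radius := hp.r_pos.trans_le hp.r_le
  have h1 := liftSeries_radius_pos
    (𝔸 := ((Fin (k + 1) → ℝ) × ℝ) →L[ℝ] ((Fin (k + 1) → ℝ) × ℝ)) hr
  have h2 := liftSeries_radius_pos (𝔸 := (Fin (k + 1) → ℝ) →L[ℝ] (Fin (k + 1) → ℝ)) hr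
  have h3 := liftSeries_radius_pos (𝔸 := ℝ →L[ℝ] ℝ) hr
  obtain ⟨s, hs0, hs⟩ := ENNReal.lt_iff_exists_nnreal_btwn.1
    (lt_min (lt_min h1 h2) (lt_min h3 hp.r_pos))
  have hs1 := hs.le.trans ((min_le_left _ _).trans (min_le_left _ _))
  have hs2 := hs.le.trans ((min_le_left _ _).trans (min_le_right _ _))
  have hs3 := hs.le.trans ((min_le_right _ _).trans (min_le_left _ _))
  have hs4 := hs.le.trans ((min_le_right _ _).trans (min_le_right _ _))
  replace hs0 : 0 < s := by exact_mod_cast hs0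
  have hs0' : (0 : ℝ) < s := by exact_mod_cast hs0
  set δ : ℝ := s / 2 with hδ
  have hδ0 : 0 < δ := by positivity
  have ha1 : AnalyticAt ℝ
      (fun y : ((Fin n → ℝ) × (Fin (k + 1) → ℝ)) × ℝ => extCompanion δ y.1.2 y.2) 0 :=
    analyticAt_extCompanion δ
      (((ContinuousLinearMap.snd ℝ (Fin n → ℝ) (Fin (k + 1) → ℝ)).comp
        (ContinuousLinearMap.fst ℝ _ ℝ)).analyticAt 0) analyticAt_snd
  have ha2 := analyticAt_operatorPoint ha1 (((ContinuousLinearMap.fst ℝ (Fin n → ℝ)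
    (Fin (k + 1) → ℝ)).comp (ContinuousLinearMap.fst ℝ _ _)).analyticAt 0)
  have hN : ∀ᶠ y : ((Fin n → ℝ) × (Fin (k + 1) → ℝ)) × ℝ in 𝓝 0,
      ‖extCompanion δ y.1.2 y.2‖ < s := by
    refine ha1.continuousAt.norm.eventually (gt_mem_nhds ?_)
    exact lt_of_le_of_lt (norm_extCompanion_zero_le hδ0.le) (half_lt_self hs0')
  have hy : ∀ᶠ y : ((Fin n → ℝ) × (Fin (k + 1) → ℝ)) × ℝ in 𝓝 0, ‖y‖ < s :=
    continuous_norm.continuousAt.eventually (gt_mem_nhds (by simpa using hs0'))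
  let F : ((Fin n → ℝ) × (Fin (k + 1) → ℝ)) × ℝ → (Fin (k + 1) → ℝ) × ℝ := fun y =>
    (liftSeries _ p).sum (operatorPoint (extCompanion δ y.1.2 y.2) y.1.1) (Pi.single 0 1, 0)
  have hF : AnalyticAt ℝ F 0 := by
    have h0 := operatorPoint_mem_eball (n := n) (e := 0) hs1 hs0 hN.self_of_nhds
      (by simpa using hs0')
    have h4 := ((liftSeries (((Fin (k + 1) → ℝ) × ℝ) →L[ℝ] ((Fin (k + 1) → ℝ) × ℝ))
      p).hasFPowerSeriesOnBall h1).analyticOnNhd _ h0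
    exact ((ContinuousLinearMap.apply ℝ ((Fin (k + 1) → ℝ) × ℝ) _).analyticAt _).comp
      (h4.fun_comp (x := (0 : ((Fin n → ℝ) × (Fin (k + 1) → ℝ)) × ℝ)) ha2)
  have hi : AnalyticAt ℝ (fun y : (Fin n → ℝ) × (Fin (k + 1) → ℝ) => F (y, 0)) 0 :=
    AnalyticAt.comp (g := F) (f := fun y => (y, (0 : ℝ))) hF
      (analyticAt_id.prod analyticAt_const)
  refine ⟨fun y j => (F (y, 0)).1 j / δ ^ (j : ℕ), fun y => (F y).2 / δ ^ (k + 1),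
    ?_, ?_, ?_⟩
  · refine AnalyticAt.pi fun j => AnalyticAt.div_const ?_
    exact (((ContinuousLinearMap.proj (R := ℝ) (φ := fun _ : Fin (k + 1) => ℝ) j).comp
      (ContinuousLinearMap.fst ℝ _ _)).analyticAt _).comp hi
  · exact AnalyticAt.div_const
      (((ContinuousLinearMap.snd ℝ (Fin (k + 1) → ℝ) ℝ).analyticAt _).comp hF)
  have hcont : Tendsto (fun y : ((Fin n → ℝ) × (Fin (k + 1) → ℝ)) × ℝ => (y.1, (0 : ℝ)))
      (𝓝 0) (𝓝 0) := Continuous.tendsto' (by fun_prop) _ _ rfl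
  filter_upwards [hN, hy, hcont.eventually hN] with y a1 a2 a3
  have he : ‖y.1.1‖ < s := ((norm_fst_le y.1).trans (norm_fst_le y)).trans_lt a2
  have e1 := evalCovector_liftSeries_sum hp hs0 hs1 hs3 hs4 hδ0.ne' a1 he
    ((norm_snd_le y).trans_lt a2)
  have e2 : (F y).1 = (F (y.1, 0)).1 := (fst_liftSeries_sum hs0 hs1 hs2 a1 he _).trans
    (fst_liftSeries_sum hs0 hs1 hs2 a3 he _).symm
  have e3 : evalCovector δ y.1.2 y.2 ((F y).1, (F y).2) = h (Fin.cons y.2 y.1.1) := e1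
  rw [← e3, evalCovector_apply, add_comm, e2]
  congr 1
  · ring
  · refine Finset.sum_congr rfl fun j _ => ?_
    rw [div_pow]
    ring

end

section

open Filter Topology Set

theorem eq_zero_of_sum_eq_pow_mul {k : ℕ} {r : Fin k → ℝ} {φ : ℝ → ℝ} {c : ℝ}
    (hφ : Tendsto φ (𝓝[≠] 0) (𝓝 c))
    (h : ∀ᶠ t in 𝓝[≠] (0 : ℝ), ∑ j, r j * t ^ (j : ℕ) = t ^ k * φ t) : r = 0 := by
  induction k with
  | zero => exact Subsingleton.elim _ _
  | succ k ih =>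
    have hs : Tendsto (fun t : ℝ => ∑ j, r j * t ^ (j : ℕ)) (𝓝[≠] 0) (𝓝 (r 0)) := by
      refine Tendsto.mono_left ?_ nhdsWithin_le_nhds
      refine Continuous.tendsto' (by fun_prop) _ _ ?_
      simp [Fin.sum_univ_succ]
    have ht : Tendsto (fun t : ℝ => t ^ (k + 1) * φ t) (𝓝[≠] 0) (𝓝 0) := by
      have : Tendsto (fun t : ℝ => t ^ (k + 1)) (𝓝[≠] 0) (𝓝 0) :=
        Tendsto.mono_left (Continuous.tendsto' (by fun_prop) _ _ (by simp)) nhdsWithin_le_nhds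
      simpa using this.mul hφ
    have h0 : r 0 = 0 := tendsto_nhds_unique (hs.congr' h) ht
    have h1 : (fun j => r (Fin.succ j)) = 0 := by
      refine ih ?_
      filter_upwards [h, self_mem_nhdsWithin] with t ht (ht0 : t ≠ 0)
      rw [Fin.sum_univ_succ] at ht
      refine mul_left_cancel₀ ht0 ?_
      simp only [h0, zero_mul, zero_add, Fin.val_succ, pow_succ] at ht
      rw [Finset.mul_sum, ← mul_assoc, mul_comm t, ← ht]
      exact Finset.sum_congr rfl fun j _ => by ring
    funext j
    exact Fin.cases h0 (fun i => congrFun h1 i) j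

theorem exists_preparation {n k : ℕ} {h : (Fin (n + 1) → ℝ) → ℝ} (hh : AnalyticAt ℝ h 0)
    {g : ℝ → ℝ} (hg : ContinuousAt g 0) (hg0 : g 0 ≠ 0)
    (hhg : ∀ᶠ t : ℝ in 𝓝 0, h (Fin.cons t 0) = t ^ (k + 1) * g t) :
    ∃ (a : (Fin n → ℝ) → (Fin (k + 1) → ℝ)) (u : (Fin n → ℝ) × ℝ → ℝ),
      AnalyticAt ℝ a 0 ∧ a 0 = 0 ∧ ContinuousAt u 0 ∧ u 0 ≠ 0 ∧
      ∀ᶠ y : (Fin n → ℝ) × ℝ in 𝓝 0,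
        h (Fin.cons y.2 y.1) = u y * (y.2 ^ (k + 1) + ∑ j, a y.1 j * y.2 ^ (j : ℕ)) := by
  obtain ⟨R, q, hR, hq, hRq⟩ := exists_generic_division hh k
  have hline : Tendsto (fun t : ℝ => ((0 : (Fin n → ℝ) × (Fin (k + 1) → ℝ)), t)) (𝓝 0) (𝓝 0) :=
    Continuous.tendsto' (by fun_prop) _ _ rfl
  have hqt : Tendsto (fun t : ℝ => q (0, t)) (𝓝[≠] 0) (𝓝 (q 0)) :=
    (hq.continuousAt.tendsto.comp hline).mono_left nhdsWithin_le_nhds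
  have hgt : Tendsto g (𝓝[≠] 0) (𝓝 (g 0)) := hg.tendsto.mono_left nhdsWithin_le_nhds
  have hR0 : R 0 = 0 := by
    refine eq_zero_of_sum_eq_pow_mul (hgt.sub hqt) ?_
    refine Filter.Eventually.filter_mono nhdsWithin_le_nhds ?_
    filter_upwards [hhg, hline.eventually hRq] with t h1 h2
    simp only [Prod.fst_zero, Prod.snd_zero, Pi.zero_apply, zero_mul, Finset.sum_const_zero,
      add_zero] at h2
    rw [mul_sub, ← h1, h2]
    ring
  have hq0 : q 0 ≠ 0 := by
    have : q 0 = g 0 := by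
      refine tendsto_nhds_unique (hqt.congr' ?_) hgt
      filter_upwards [hhg.filter_mono nhdsWithin_le_nhds,
        (hline.eventually hRq).filter_mono nhdsWithin_le_nhds, self_mem_nhdsWithin] with
        t h1 h2 (h3 : t ≠ 0)
      simp only [Prod.fst_zero, Prod.snd_zero, Pi.zero_apply, zero_mul, Finset.sum_const_zero,
        add_zero, hR0] at h2
      rw [h1, mul_comm] at h2
      exact (mul_right_cancel₀ (pow_ne_zero _ h3) h2).symm
    rwa [this]
  set L := fderiv ℝ R 0
  have hL : HasStrictFDerivAt R L 0 := hR.hasStrictFDerivAt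
  have hinj : ∀ b : Fin (k + 1) → ℝ, L (0, b) = 0 → b = 0 := by
    intro b hb
    have hqb : Tendsto (fun t : ℝ => fderiv ℝ q (0, t) ((0, b), 0)) (𝓝[≠] 0)
        (𝓝 (fderiv ℝ q 0 ((0, b), 0))) := by
      refine Tendsto.mono_left ?_ nhdsWithin_le_nhds
      exact (((ContinuousLinearMap.apply ℝ ℝ
        (((0, b), 0) : ((Fin n → ℝ) × (Fin (k + 1) → ℝ)) × ℝ)).continuous.tendsto _).comp
        hq.fderiv.continuousAt.tendsto).comp hline
    refine eq_zero_of_sum_eq_pow_mul (hqb.neg.div hqt hq0) ?_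
    filter_upwards [(hline.eventually hRq.eventually_nhds).filter_mono nhdsWithin_le_nhds,
      (hline.eventually hq.eventually_analyticAt).filter_mono nhdsWithin_le_nhds,
      hqt.eventually_ne hq0] with t h1 h2 h3
    have hc : HasDerivAt (fun s : ℝ => (((0 : Fin n → ℝ), s • b), t)) ((0, b), 0) 0 := by
      refine HasDerivAt.prodMk (HasDerivAt.prodMk (hasDerivAt_const _ _) ?_) (hasDerivAt_const _ _)
      simpa using (hasDerivAt_id (0 : ℝ)).smul_const b
    have hc' : HasDerivAt (fun s : ℝ => ((0 : Fin n → ℝ), s • b)) (0, b) 0 := by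
      refine HasDerivAt.prodMk (hasDerivAt_const _ _) ?_
      simpa using (hasDerivAt_id (0 : ℝ)).smul_const b
    have d1 : HasDerivAt (fun s : ℝ => q ((0, s • b), t)) (fderiv ℝ q (0, t) ((0, b), 0)) 0 :=
      HasFDerivAt.comp_hasDerivAt_of_eq (x := (0 : ℝ)) (l := q) h2.differentiableAt.hasFDerivAt hc
        (by rw [zero_smul]; rfl)
    have d2 : HasDerivAt (fun s : ℝ => R (0, s • b)) (L (0, b)) 0 :=
      HasFDerivAt.comp_hasDerivAt_of_eq (x := (0 : ℝ)) (l := R) hL.hasFDerivAt hc'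
        (by rw [zero_smul]; rfl)
    rw [hb, hasDerivAt_pi] at d2
    have d3 : HasDerivAt (fun s : ℝ => t ^ (k + 1) + ∑ j, (s • b) j * t ^ (j : ℕ))
        (∑ j, b j * t ^ (j : ℕ)) 0 := by
      refine HasDerivAt.const_add _ (HasDerivAt.fun_sum fun j _ => ?_)
      simpa using ((hasDerivAt_id (0 : ℝ)).mul_const (b j)).mul_const (t ^ (j : ℕ))
    have d4 := (d1.mul d3).add (HasDerivAt.fun_sum (u := Finset.univ)
      fun j _ => (d2 j).mul_const (t ^ (j : ℕ)))
    have h1' : (𝓝 ((0 : (Fin n → ℝ) × (Fin (k + 1) → ℝ)), t)) =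
        𝓝 (((0 : Fin n → ℝ), (0 : ℝ) • b), t) := by
      rw [zero_smul]; rfl
    rw [h1'] at h1
    have d5 := hc.continuousAt.tendsto.eventually h1
    have d6 := (d4.congr_of_eventuallyEq d5).unique
      (hasDerivAt_const (0 : ℝ) (h (Fin.cons t (0 : Fin n → ℝ))))
    simp only [zero_smul, Pi.zero_apply, zero_mul, Finset.sum_const_zero, add_zero] at d6
    change q ((0, 0), t) ≠ 0 at h3
    change _ = t ^ (k + 1) * (- _ / q ((0, 0), t))
    field_simp
    linear_combination d6
  let L' : ((Fin n → ℝ) × (Fin (k + 1) → ℝ)) →L[ℝ] ((Fin n → ℝ) × (Fin (k + 1) → ℝ)) :=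
    (ContinuousLinearMap.fst ℝ _ _).prod L
  have hL'inj : Function.Injective L'.toLinearMap := by
    rw [injective_iff_map_eq_zero]
    rintro ⟨e, b⟩ heb
    obtain ⟨h1, h2⟩ := Prod.ext_iff.1 heb
    change e = 0 at h1
    change L (e, b) = 0 at h2
    subst h1
    rw [hinj b h2]
    rfl
  let i : ((Fin n → ℝ) × (Fin (k + 1) → ℝ)) ≃L[ℝ] ((Fin n → ℝ) × (Fin (k + 1) → ℝ)) :=
    (LinearEquiv.ofInjectiveEndo L'.toLinearMap hL'inj).toContinuousLinearEquiv
  have hi : (i : _ →L[ℝ] _) = L' := by ext x <;> rfl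
  let Φ : (Fin n → ℝ) × (Fin (k + 1) → ℝ) → (Fin n → ℝ) × (Fin (k + 1) → ℝ) := fun y => (y.1, R y)
  have hΦ : AnalyticAt ℝ Φ 0 := analyticAt_fst.prod hR
  have hΦ' : HasStrictFDerivAt Φ (i : _ →L[ℝ] _) 0 := by
    rw [hi]
    exact hasStrictFDerivAt_fst.prodMk hL
  let Ψ := hΦ'.toOpenPartialHomeomorph Φ
  have hΨ0 : 0 ∈ Ψ.source := hΦ'.mem_toOpenPartialHomeomorph_source
  have hΦ0 : Φ 0 = 0 := Prod.ext rfl hR0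
  have hsymm : AnalyticAt ℝ Ψ.symm (Ψ 0) :=
    Ψ.analyticAt_symm' hΨ0 hΦ hΦ'.hasFDerivAt.fderiv
  have hΨΦ : Ψ 0 = 0 := hΦ0
  have hsymm0 : Ψ.symm 0 = 0 := by rw [← hΨΦ, Ψ.left_inv hΨ0, hΨΦ]
  rw [hΨΦ] at hsymm
  have hin : AnalyticAt ℝ (fun e : Fin n → ℝ => (e, (0 : Fin (k + 1) → ℝ))) 0 :=
    analyticAt_id.prod analyticAt_const
  have htar : ∀ᶠ e : Fin n → ℝ in 𝓝 0, (e, (0 : Fin (k + 1) → ℝ)) ∈ Ψ.target := by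
    refine hin.continuousAt.tendsto.eventually ?_
    refine Ψ.open_target.mem_nhds ?_
    have := Ψ.map_source hΨ0
    rwa [hΨΦ] at this
  have hΨa : AnalyticAt ℝ (fun e : Fin n → ℝ => Ψ.symm (e, 0)) 0 :=
    AnalyticAt.comp (g := Ψ.symm) (f := fun e : Fin n → ℝ => (e, (0 : Fin (k + 1) → ℝ))) hsymm hin
  have haa : AnalyticAt ℝ (fun e : Fin n → ℝ => (Ψ.symm (e, 0)).2) 0 := analyticAt_snd.comp hΨa
  have ha0 : (Ψ.symm (0, 0)).2 = 0 := by
    change (Ψ.symm 0).2 = 0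
    rw [hsymm0]; rfl
  have hroot : ∀ᶠ e : Fin n → ℝ in 𝓝 0, R (e, (Ψ.symm (e, 0)).2) = 0 := by
    filter_upwards [htar] with e he
    obtain ⟨h1, h2⟩ := Prod.ext_iff.1 (show Φ (Ψ.symm (e, 0)) = (e, 0) from Ψ.right_inv he)
    change (Ψ.symm (e, 0)).1 = e at h1
    have : (e, (Ψ.symm (e, 0)).2) = Ψ.symm (e, 0) := Prod.ext h1.symm rfl
    rw [this]
    exact h2
  have hcu : ContinuousAt (fun y : (Fin n → ℝ) × ℝ => ((y.1, (Ψ.symm (y.1, 0)).2), y.2)) 0 := by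
    refine ContinuousAt.prodMk (ContinuousAt.prodMk continuousAt_fst ?_) continuousAt_snd
    exact haa.continuousAt.comp (f := Prod.fst) (x := (0 : (Fin n → ℝ) × ℝ)) continuousAt_fst
  have hcu0 : (((0 : (Fin n → ℝ) × ℝ).1, (Ψ.symm ((0 : (Fin n → ℝ) × ℝ).1, 0)).2),
      (0 : (Fin n → ℝ) × ℝ).2) = 0 := by
    change ((0, (Ψ.symm (0, 0)).2), (0 : ℝ)) = _
    rw [ha0]; rfl
  have hcut := hcu.tendsto
  rw [hcu0] at hcut
  refine ⟨fun e => (Ψ.symm (e, 0)).2, fun y => q ((y.1, (Ψ.symm (y.1, 0)).2), y.2),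
    haa, ha0, ?_, ?_, ?_⟩
  · exact ContinuousAt.comp_of_eq (g := q) hq.continuousAt hcu hcu0
  · change q (((0 : (Fin n → ℝ) × ℝ).1, (Ψ.symm ((0 : (Fin n → ℝ) × ℝ).1, 0)).2),
      (0 : (Fin n → ℝ) × ℝ).2) ≠ 0
    rwa [hcu0]
  · filter_upwards [hcut.eventually hRq,
      (continuous_fst.tendsto (0 : (Fin n → ℝ) × ℝ)).eventually hroot] with y h1 h2
    rw [h1, h2]
    simp

end

section

open Filter Topology Set Polynomial

/-- The functions on `ℝⁿ` that are analytic at the origin. -/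
def Germs (n : ℕ) : Subalgebra ℝ ((Fin n → ℝ) → ℝ) where
  carrier := {f | AnalyticAt ℝ f 0}
  mul_mem' ha hb := AnalyticAt.mul ha hb
  add_mem' ha hb := AnalyticAt.add ha hb
  algebraMap_mem' _ := analyticAt_const

variable {n : ℕ}

/-- Evaluation of germs at a point. -/
def ev (e : Fin n → ℝ) : Germs n →+* ℝ :=
  (Pi.evalRingHom (fun _ => ℝ) e).comp (Germs n).val.toRingHom

theorem ev_apply (e : Fin n → ℝ) (f : Germs n) : ev e f = f.1 e := rfl

theorem analyticAt_ev (f : Germs n) : AnalyticAt ℝ (fun e => ev e f) 0 := f.2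

theorem ev_algebraMap (e : Fin n → ℝ) (c : ℝ) : ev e (algebraMap ℝ (Germs n) c) = c := rfl

instance : Nontrivial (Germs n) := (ev (0 : Fin n → ℝ)).domain_nontrivial

theorem exists_ev_le (f : Germs n) (hf : ev 0 f = 0) :
    ∃ K, ∀ᶠ e : Fin n → ℝ in 𝓝 0, |ev e f| ≤ K * ‖e‖ := by
  obtain ⟨K, hK⟩ := (analyticAt_ev f).differentiableAt.isBigO_sub.bound
  exact ⟨K, by simpa [hf] using hK⟩

theorem continuousAt_eval_map_ev (χ : (Germs n)[X]) (t : ℝ) :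
    ContinuousAt (fun p : (Fin n → ℝ) × ℝ => (χ.map (ev p.1)).eval p.2) (0, t) := by
  simp only [eval_map, eval₂_eq_sum_range]
  refine tendsto_finsetSum _ fun i _ => ?_
  refine ContinuousAt.mul ?_ (continuousAt_snd.pow _)
  exact ContinuousAt.comp_of_eq (g := fun e : Fin n → ℝ => ev e (χ.coeff i))
    (analyticAt_ev _).continuousAt continuousAt_fst rfl

/-- A Weierstrass polynomial: monic, with all lower coefficients vanishing at the origin. -/
def Distinguished (w : (Germs n)[X]) : Prop :=
  w.Monic ∧ w.map (ev 0) = X ^ w.natDegree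

theorem Distinguished.of_eq {w : (Germs n)[X]} {d : ℕ} (hw : w.Monic) (h : w.map (ev 0) = X ^ d) :
    Distinguished w := by
  refine ⟨hw, ?_⟩
  rw [h, ← hw.natDegree_map (ev (0 : Fin n → ℝ)), h, natDegree_X_pow]

theorem Distinguished.one : Distinguished (1 : (Germs n)[X]) := ⟨monic_one, by simp⟩

theorem Distinguished.X : Distinguished (X : (Germs n)[X]) := ⟨monic_X, by simp⟩

theorem Distinguished.mul {v w : (Germs n)[X]} (hv : Distinguished v) (hw : Distinguished w) :
    Distinguished (v * w) :=
  .of_eq (d := v.natDegree + w.natDegree) (hv.1.mul hw.1)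
    (by rw [Polynomial.map_mul, hv.2, hw.2, pow_add])

theorem Distinguished.prod {ι : Type*} (s : Finset ι) {w : ι → (Germs n)[X]}
    (hw : ∀ i ∈ s, Distinguished (w i)) : Distinguished (∏ i ∈ s, w i) := by
  classical
  induction s using Finset.induction_on with
  | empty => simpa using Distinguished.one
  | insert i s hi ih =>
    rw [Finset.prod_insert hi]
    exact (hw _ (by simp)).mul (ih fun j hj => hw j (by simp [hj]))

theorem Distinguished.comp_X_add_C {w : (Germs n)[X]} (hw : Distinguished w) {f : Germs n}
    (hf : ev 0 f = 0) : Distinguished (w.comp (Polynomial.X + C f)) := by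
  refine .of_eq (d := w.natDegree) (hw.1.comp_X_add_C f) ?_
  rw [Polynomial.map_comp, hw.2]
  simp [hf]

theorem Distinguished.derivative {w : (Germs n)[X]} (hw : Distinguished w)
    (hd : w.natDegree ≠ 0) :
    Distinguished (C (algebraMap ℝ (Germs n) (w.natDegree : ℝ)⁻¹) * derivative w) := by
  have hd' : (w.natDegree : ℝ) ≠ 0 := by exact_mod_cast hd
  refine .of_eq (d := w.natDegree - 1) ?_ ?_
  · refine monic_of_natDegree_le_of_coeff_eq_one (w.natDegree - 1) ?_ ?_
    · exact (natDegree_C_mul_le _ _).trans (natDegree_derivative_le w)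
    · rw [coeff_C_mul, coeff_derivative, Nat.sub_add_cancel (Nat.one_le_iff_ne_zero.2 hd),
        hw.1.coeff_natDegree, one_mul]
      have : ((w.natDegree - 1 : ℕ) : Germs n) + 1 = algebraMap ℝ (Germs n) (w.natDegree : ℝ) := by
        rw [map_natCast, ← Nat.cast_succ]
        congr 1; omega
      rw [this, ← map_mul, inv_mul_cancel₀ hd', map_one]
  · rw [Polynomial.map_mul, map_C, ev_algebraMap, ← derivative_map, hw.2, derivative_X_pow,
      ← mul_assoc, ← C_mul, inv_mul_cancel₀ hd']
    simp

theorem Distinguished.coeff_zero {w : (Germs n)[X]} (hw : Distinguished w) {j : ℕ}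
    (hj : j < w.natDegree) : ev 0 (w.coeff j) = 0 := by
  rw [← coeff_map, hw.2, coeff_X_pow, if_neg hj.ne]

theorem eval_map_eq_of_monic {w : (Germs n)[X]} (hw : w.Monic) (e : Fin n → ℝ) (t : ℝ) :
    (w.map (ev e)).eval t = t ^ w.natDegree +
      ∑ j ∈ Finset.range w.natDegree, ev e (w.coeff j) * t ^ j := by
  rw [eval_map, eval₂_eq_sum_range, Finset.sum_range_succ, hw.coeff_natDegree, map_one, one_mul,
    add_comm]

theorem Distinguished.exists_root_bound {w : (Germs n)[X]} (hw : Distinguished w) :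
    ∃ K, ∀ᶠ e : Fin n → ℝ in 𝓝 0, ∀ t, (w.map (ev e)).eval t = 0 →
      |t| ^ w.natDegree ≤ K * ‖e‖ ∧ |t| ≤ 1 := by
  have h1 : ∀ j ∈ Finset.range w.natDegree,
      ∃ K, ∀ᶠ e : Fin n → ℝ in 𝓝 0, |ev e (w.coeff j)| ≤ K * ‖e‖ := fun j hj =>
    exists_ev_le _ (hw.coeff_zero (Finset.mem_range.1 hj))
  choose! K hK using h1
  set K' := ∑ j ∈ Finset.range w.natDegree, K j
  refine ⟨K', ?_⟩
  have h2 : ∀ᶠ e : Fin n → ℝ in 𝓝 0, K' * ‖e‖ < 1 :=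
    (Continuous.tendsto' (by fun_prop) (0 : Fin n → ℝ) (0 : ℝ) (by simp)).eventually
      (gt_mem_nhds one_pos)
  filter_upwards [(Finset.range w.natDegree).eventually_all.2 hK, h2] with e he h2 t ht
  rw [eval_map_eq_of_monic hw.1, add_eq_zero_iff_eq_neg] at ht
  have hpos : 0 ≤ K' * ‖e‖ := by
    rw [Finset.sum_mul]
    exact Finset.sum_nonneg fun j hj => (abs_nonneg _).trans (he j hj)
  have key : ∀ B, (∀ j < w.natDegree, |t| ^ j ≤ B) → |t| ^ w.natDegree ≤ K' * ‖e‖ * B := by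
    intro B hB
    rw [← abs_pow, ht, abs_neg, Finset.sum_mul, Finset.sum_mul]
    refine (Finset.abs_sum_le_sum_abs _ _).trans (Finset.sum_le_sum fun j hj => ?_)
    rw [abs_mul, abs_pow]
    exact mul_le_mul (he j hj) (hB j (Finset.mem_range.1 hj)) (by positivity)
      ((abs_nonneg _).trans (he j hj))
  have ht1 : |t| ≤ 1 := by
    by_contra! hlt
    have h3 := key (|t| ^ w.natDegree) fun j hj => pow_le_pow_right₀ hlt.le hj.le
    nlinarith [pow_pos (one_pos.trans hlt) w.natDegree]
  exact ⟨by simpa using key 1 fun j _ => pow_le_one₀ (abs_nonneg t) ht1, ht1⟩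

theorem Distinguished.tendsto_root {w : (Germs n)[X]} (hw : Distinguished w) {l : Filter ℕ}
    {y : ℕ → Fin n → ℝ} {t : ℕ → ℝ} (hy : Tendsto y l (𝓝 0))
    (ht : ∀ᶠ k in l, (w.map (ev (y k))).eval (t k) = 0) : Tendsto t l (𝓝 0) := by
  obtain ⟨K, hK⟩ := hw.exists_root_bound
  rcases eq_or_ne w.natDegree 0 with hd | hd
  · have : w = 1 := hw.1.natDegree_eq_zero.1 hd
    subst this
    simp only [Polynomial.map_one, eval_one, one_ne_zero, eventually_false_iff_eq_bot] at ht
    simp [ht]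
  have h1 : Tendsto (fun k => |t k| ^ w.natDegree) l (𝓝 0) := by
    refine squeeze_zero' (Eventually.of_forall fun k => by positivity) ?_
      (show Tendsto (fun k => K * ‖y k‖) l (𝓝 0) by simpa using hy.norm.const_mul K)
    filter_upwards [hy.eventually hK, ht] with k h1 h2
    exact (h1 _ h2).1
  rw [tendsto_zero_iff_abs_tendsto_zero]
  have h2 : Tendsto (fun k => (|t k| ^ w.natDegree) ^ ((w.natDegree : ℝ)⁻¹)) l (𝓝 0) := by
    have := h1.rpow_const (p := (w.natDegree : ℝ)⁻¹) (Or.inr (by positivity))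
    rwa [Real.zero_rpow (by positivity)] at this
  refine h2.congr fun k => ?_
  rw [Real.pow_rpow_inv_natCast (abs_nonneg _) hd]
  rfl

end

section

open Filter Topology Set Polynomial

variable {n : ℕ}

theorem continuousAt_cons :
    ContinuousAt (fun y : (Fin n → ℝ) × ℝ => (Fin.cons y.2 y.1 : Fin (n + 1) → ℝ)) 0 := by
  refine Continuous.continuousAt ?_
  refine continuous_pi fun i => ?_
  refine Fin.cases ?_ (fun j => ?_) i
  · simpa using continuous_snd
  · simp only [Fin.cons_succ]
    fun_prop

theorem cons_zero_zero : (Fin.cons (0 : ℝ) (0 : Fin n → ℝ) : Fin (n + 1) → ℝ) = 0 := by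
  funext i
  exact Fin.cases rfl (fun _ => rfl) i

theorem analyticAt_cons_zero {h : (Fin (n + 1) → ℝ) → ℝ} (hh : AnalyticAt ℝ h 0) :
    AnalyticAt ℝ (fun t : ℝ => h (Fin.cons t 0)) 0 := by
  refine AnalyticAt.comp_of_eq (g := h) (f := fun t : ℝ => (Fin.cons t 0 : Fin (n + 1) → ℝ))
    hh ?_ cons_zero_zero
  refine AnalyticAt.pi fun i => ?_
  refine Fin.cases ?_ (fun j => ?_) i
  · exact analyticAt_id
  · exact analyticAt_const

theorem exists_remainder {h : (Fin (n + 1) → ℝ) → ℝ} (hh : AnalyticAt ℝ h 0)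
    {w : (Germs n)[X]} (hw : Distinguished w) :
    ∃ ρ : (Germs n)[X], ∀ᶠ y : (Fin n → ℝ) × ℝ in 𝓝 0, (w.map (ev y.1)).eval y.2 = 0 →
      h (Fin.cons y.2 y.1) = (ρ.map (ev y.1)).eval y.2 := by
  rcases hd : w.natDegree with _ | k
  · have : w = 1 := hw.1.natDegree_eq_zero.1 hd
    subst this
    exact ⟨0, by simp⟩
  obtain ⟨R, q, hR, hq, hRq⟩ := exists_generic_division hh k
  let a : (Fin n → ℝ) → Fin (k + 1) → ℝ := fun e j => ev e (w.coeff j)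
  have ha : AnalyticAt ℝ a 0 := AnalyticAt.pi fun j => analyticAt_ev _
  have ha0 : a 0 = 0 := by
    funext j
    exact hw.coeff_zero (by rw [hd]; exact j.2)
  have hRa : AnalyticAt ℝ (fun e => R (e, a e)) 0 := by
    refine AnalyticAt.comp_of_eq (g := R) hR (analyticAt_id.prod ha) ?_
    rw [ha0]; rfl
  have hRj : ∀ j, AnalyticAt ℝ (fun e => R (e, a e) j) 0 := fun j =>
    ((ContinuousLinearMap.proj (R := ℝ) (φ := fun _ : Fin (k + 1) => ℝ) j).analyticAt _).comp hRa
  refine ⟨∑ j : Fin (k + 1), C (⟨_, hRj j⟩ : Germs n) * X ^ (j : ℕ), ?_⟩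
  have hc : Tendsto (fun y : (Fin n → ℝ) × ℝ => ((y.1, a y.1), y.2)) (𝓝 0) (𝓝 0) := by
    have : ContinuousAt (fun y : (Fin n → ℝ) × ℝ => ((y.1, a y.1), y.2)) 0 := by
      refine ContinuousAt.prodMk (ContinuousAt.prodMk continuousAt_fst ?_) continuousAt_snd
      exact ContinuousAt.comp_of_eq (g := a) ha.continuousAt continuousAt_fst rfl
    have h2 := this.tendsto
    simp only [Prod.fst_zero, Prod.snd_zero, ha0] at h2
    exact h2
  filter_upwards [hc.eventually hRq] with y h1 h2
  rw [eval_map_eq_of_monic hw.1, hd, ← Fin.sum_univ_eq_sum_range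
    (fun j => ev y.1 (w.coeff j) * y.2 ^ j)] at h2
  rw [h1]
  change q _ * (y.2 ^ (k + 1) + ∑ j : Fin (k + 1), ev y.1 (w.coeff j) * y.2 ^ (j : ℕ)) + _ = _
  rw [h2, mul_zero, zero_add]
  simp [Polynomial.map_sum, eval_finsetSum, ev_apply]

theorem exists_distinguished {h : (Fin (n + 1) → ℝ) → ℝ} (hh : AnalyticAt ℝ h 0)
    (h0 : ¬ ∀ᶠ t : ℝ in 𝓝 0, h (Fin.cons t 0) = 0) :
    ∃ (w : (Germs n)[X]) (u : (Fin n → ℝ) × ℝ → ℝ), Distinguished w ∧ ContinuousAt u 0 ∧ u 0 ≠ 0 ∧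
      ∀ᶠ y : (Fin n → ℝ) × ℝ in 𝓝 0, h (Fin.cons y.2 y.1) = u y * (w.map (ev y.1)).eval y.2 := by
  obtain ⟨d, g, hg, hg0, hhg⟩ :=
    (analyticAt_cons_zero hh).exists_eventuallyEq_pow_smul_nonzero_iff.2 h0
  simp only [sub_zero, smul_eq_mul] at hhg
  rcases d with _ | k
  · refine ⟨1, fun y => h (Fin.cons y.2 y.1), .one, ?_, ?_, by simp⟩
    · exact ContinuousAt.comp_of_eq (g := h) hh.continuousAt continuousAt_cons cons_zero_zero
    · change h (Fin.cons 0 0) ≠ 0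
      rw [hhg.self_of_nhds]
      simpa
  obtain ⟨a, u, ha, ha0, hu, hu0, hhu⟩ := exists_preparation hh hg.continuousAt hg0 hhg
  have haj : ∀ j, AnalyticAt ℝ (fun e => a e j) 0 := fun j =>
    ((ContinuousLinearMap.proj (R := ℝ) (φ := fun _ : Fin (k + 1) => ℝ) j).analyticAt _).comp ha
  refine ⟨X ^ (k + 1) + ∑ j : Fin (k + 1), C (⟨_, haj j⟩ : Germs n) * X ^ (j : ℕ), u, ?_, hu, hu0,
    ?_⟩
  · refine .of_eq (d := k + 1) (monic_X_pow_add ?_) ?_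
    · exact degree_sum_fin_lt _
    · simp [Polynomial.map_sum, ev_apply, ha0]
  · filter_upwards [hhu] with y hy
    rw [hy]
    simp [Polynomial.map_sum, eval_finsetSum, ev_apply]

end

section

open Filter Topology Set Polynomial

/-- A sequence along which every analytic germ either vanishes or is bounded below by a power of
the norm. -/
def Good {E : Type*} [NormedAddCommGroup E] [NormedSpace ℝ E] (𝒰 : Filter ℕ) (y : ℕ → E) : Prop :=
  ∀ h : E → ℝ, AnalyticAt ℝ h 0 →
    (∀ᶠ k in 𝒰, h (y k) = 0) ∨ ∃ M : ℕ, ∀ᶠ k in 𝒰, ‖y k‖ ^ M ≤ |h (y k)|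

variable {n : ℕ}

theorem exists_pow_le_of_pow_le_mul {l : Filter ℕ} {f g : ℕ → ℝ} {M : ℕ} {K : ℝ}
    (hf : Tendsto f l (𝓝 0)) (hf0 : ∀ k, 0 ≤ f k) (hg : ∀ k, 0 ≤ g k)
    (h : ∀ᶠ k in l, f k ^ M ≤ K * g k) : ∀ᶠ k in l, f k ^ (M + 1) ≤ g k := by
  have h1 : Tendsto (fun k => f k * K) l (𝓝 0) := by simpa using hf.mul_const K
  filter_upwards [h, h1.eventually (gt_mem_nhds one_pos)] with k h1 h2
  calc f k ^ (M + 1) = f k * f k ^ M := pow_succ' _ _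
    _ ≤ f k * (K * g k) := mul_le_mul_of_nonneg_left h1 (hf0 k)
    _ = f k * K * g k := by ring
    _ ≤ 1 * g k := mul_le_mul_of_nonneg_right h2.le (hg k)
    _ = g k := one_mul _

theorem Good.map {E F : Type*} [NormedAddCommGroup E] [NormedSpace ℝ E] [NormedAddCommGroup F]
    [NormedSpace ℝ F] {l : Filter ℕ} {y : ℕ → E} (hy : Good l y) (hy0 : Tendsto y l (𝓝 0))
    (σ : E ≃L[ℝ] F) : Good l (fun k => σ (y k)) := by
  intro h hh
  rcases hy (h ∘ σ) (AnalyticAt.comp_of_eq hh ((σ : E →L[ℝ] F).analyticAt _) (map_zero σ)) with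
    h1 | ⟨M, hM⟩
  · exact Or.inl h1
  · refine Or.inr ⟨M + 1, ?_⟩
    have h2 : Tendsto (fun k => ‖σ (y k)‖) l (𝓝 0) := by
      simpa using ((σ.continuous.tendsto 0).comp hy0).norm
    refine exists_pow_le_of_pow_le_mul h2 (fun k => norm_nonneg _) (fun k => abs_nonneg _)
      (K := ‖(σ : E →L[ℝ] F)‖ ^ M) ?_
    filter_upwards [hM] with k hk
    calc ‖σ (y k)‖ ^ M ≤ (‖(σ : E →L[ℝ] F)‖ * ‖y k‖) ^ M :=
          pow_le_pow_left₀ (norm_nonneg _) ((σ : E →L[ℝ] F).le_opNorm _) _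
      _ = ‖(σ : E →L[ℝ] F)‖ ^ M * ‖y k‖ ^ M := mul_pow _ _ _
      _ ≤ _ := mul_le_mul_of_nonneg_left hk (by positivity)

theorem exists_coeff_le {𝒰 : Ultrafilter ℕ} {y : ℕ → Fin n → ℝ} (hy : Tendsto y 𝒰 (𝓝 0))
    {z : ℕ → ℝ} {c : ℝ} (hz : Tendsto z 𝒰 (𝓝 c)) (hz0 : ∀ᶠ k in 𝒰, z k ≠ 0) (i : ℕ)
    {χ : (Germs n)[X]} (hi : ¬ ∀ᶠ k in 𝒰, ev (y k) (χ.coeff i) = 0)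
    (hχ : ∀ᶠ k in 𝒰, (χ.map (ev (y k))).eval (z k) = 0) :
    ∃ (f : Germs n) (K : ℝ), (¬ ∀ᶠ k in 𝒰, ev (y k) f = 0) ∧
      ∀ᶠ k in 𝒰, |ev (y k) f| ≤ K * |z k| := by
  have key : ∀ (χ : (Germs n)[X]) k, (χ.map (ev (y k))).eval (z k) =
      (χ.divX.map (ev (y k))).eval (z k) * z k + ev (y k) (χ.coeff 0) := fun χ k => by
    conv_lhs => rw [← divX_mul_X_add χ]
    simp
  have main : ∀ χ : (Germs n)[X], (∀ᶠ k in 𝒰, (χ.map (ev (y k))).eval (z k) = 0) →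
      ∃ K, ∀ᶠ k in 𝒰, |ev (y k) (χ.coeff 0)| ≤ K * |z k| := by
    intro χ hχ
    have h1 := ((continuousAt_eval_map_ev χ.divX c).tendsto.comp (hy.prodMk_nhds hz)).abs
    refine ⟨|(χ.divX.map (ev 0)).eval c| + 1, ?_⟩
    filter_upwards [hχ, h1.eventually (gt_mem_nhds (lt_add_one _))] with k h2 h3
    rw [key, add_eq_zero_iff_eq_neg] at h2
    rw [← abs_neg, ← h2, abs_mul]
    exact mul_le_mul_of_nonneg_right h3.le (abs_nonneg _)
  induction i generalizing χ with
  | zero => exact ⟨_, (main χ hχ).imp fun K hK => ⟨hi, hK⟩⟩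
  | succ i ih =>
    by_cases h0 : ∀ᶠ k in 𝒰, ev (y k) (χ.coeff 0) = 0
    · refine ih (χ := χ.divX) (by rwa [coeff_divX]) ?_
      filter_upwards [hχ, h0, hz0] with k h1 h2 h3
      rw [key, h2, add_zero] at h1
      exact (mul_eq_zero.1 h1).resolve_right h3
    · exact ⟨_, (main χ hχ).imp fun K hK => ⟨h0, hK⟩⟩

theorem exists_monic_eval_eq_zero {w : (Germs n)[X]} (hw : w.Monic) (ρ : (Germs n)[X]) :
    ∃ χ : (Germs n)[X], χ.Monic ∧ ∀ (e : Fin n → ℝ) (t : ℝ), (w.map (ev e)).eval t = 0 →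
      (χ.map (ev e)).eval ((ρ.map (ev e)).eval t) = 0 := by
  have := hw.finite_adjoinRoot
  obtain ⟨χ, hχ, h0⟩ := Algebra.IsIntegral.isIntegral (R := Germs n) (AdjoinRoot.mk w ρ)
  refine ⟨χ, hχ, fun e t ht => ?_⟩
  rw [eval_map] at ht
  have h1 := congrArg (AdjoinRoot.lift (ev e) t ht) h0
  rw [hom_eval₂, map_zero, AdjoinRoot.lift_mk] at h1
  rw [eval_map, eval_map]
  have h2 : (AdjoinRoot.lift (ev e) t ht).comp (algebraMap (Germs n) (AdjoinRoot w)) = ev e :=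
    RingHom.ext fun f => AdjoinRoot.lift_of ht
  rwa [h2] at h1

theorem norm_cons_pow_le {t : ℝ} {e : Fin n → ℝ} {d : ℕ} {K : ℝ} (hd : d ≠ 0)
    (h : |t| ^ d ≤ K * ‖e‖) (he : ‖e‖ ≤ 1) :
    ‖(Fin.cons t e : Fin (n + 1) → ℝ)‖ ^ d ≤ max K 1 * ‖e‖ := by
  have h1 : ‖(Fin.cons t e : Fin (n + 1) → ℝ)‖ = max |t| ‖e‖ := by
    refine le_antisymm ((pi_norm_le_iff_of_nonneg (by positivity)).2 fun i => ?_) (max_le ?_ ?_)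
    · refine Fin.cases (le_max_left _ _) (fun j => ?_) i
      exact (norm_le_pi_norm e j).trans (le_max_right _ _)
    · exact norm_le_pi_norm (Fin.cons t e : Fin (n + 1) → ℝ) 0
    · refine (pi_norm_le_iff_of_nonneg (norm_nonneg _)).2 fun i => ?_
      simpa using norm_le_pi_norm (Fin.cons t e : Fin (n + 1) → ℝ) i.succ
  rw [h1]
  rcases max_cases |t| ‖e‖ with ⟨h2, -⟩ | ⟨h2, -⟩
  · rw [h2]
    exact h.trans (mul_le_mul_of_nonneg_right (le_max_left _ _) (norm_nonneg _))
  · rw [h2]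
    refine (pow_le_of_le_one (norm_nonneg _) he hd).trans ?_
    exact le_mul_of_one_le_left (norm_nonneg _) (le_max_right _ _)

theorem tendsto_cons {l : Filter ℕ} {y : ℕ → Fin n → ℝ} {t : ℕ → ℝ} (hy : Tendsto y l (𝓝 0))
    (ht : Tendsto t l (𝓝 0)) :
    Tendsto (fun k => (Fin.cons (t k) (y k) : Fin (n + 1) → ℝ)) l (𝓝 0) := by
  have h1 := continuousAt_cons.tendsto.comp (show Tendsto (fun k => (y k, t k)) l (𝓝 0) from
    hy.prodMk_nhds ht)
  simp only [Prod.fst_zero, Prod.snd_zero, cons_zero_zero] at h1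
  exact h1

theorem Good.cons_root {𝒰 : Ultrafilter ℕ} {y : ℕ → Fin n → ℝ} (hy : Tendsto y 𝒰 (𝓝 0))
    (hgood : Good 𝒰 y) {w : (Germs n)[X]} (hw : Distinguished w) {t : ℕ → ℝ}
    (ht : ∀ᶠ k in 𝒰, (w.map (ev (y k))).eval (t k) = 0) :
    Good 𝒰 (fun k => (Fin.cons (t k) (y k) : Fin (n + 1) → ℝ)) := by
  intro h hh
  have ht0 := hw.tendsto_root hy ht
  have hcons := tendsto_cons hy ht0
  have hz : Tendsto (fun k => h (Fin.cons (t k) (y k))) 𝒰 (𝓝 (h 0)) :=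
    hh.continuousAt.tendsto.comp hcons
  by_cases hz0 : ∀ᶠ k in 𝒰, h (Fin.cons (t k) (y k)) = 0
  · exact Or.inl hz0
  right
  have hz1 : ∀ᶠ k in 𝒰, h (Fin.cons (t k) (y k)) ≠ 0 := Ultrafilter.eventually_not.2 hz0
  obtain ⟨ρ, hρ⟩ := exists_remainder hh hw
  obtain ⟨χ, hχ, hχ0⟩ := exists_monic_eval_eq_zero hw.1 ρ
  have hχz : ∀ᶠ k in 𝒰, (χ.map (ev (y k))).eval (h (Fin.cons (t k) (y k))) = 0 := by
    filter_upwards [ht, (show Tendsto (fun k => (y k, t k)) 𝒰 (𝓝 0) from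
      hy.prodMk_nhds ht0).eventually hρ] with k h1 h2
    rw [h2 h1]
    exact hχ0 _ _ h1
  obtain ⟨f, K, hf, hfK⟩ := exists_coeff_le hy hz hz1 χ.natDegree
    (by simp [hχ.coeff_natDegree, 𝒰.neBot.ne]) hχz
  obtain ⟨M, hM⟩ := (hgood (fun e => ev e f) (analyticAt_ev f)).resolve_left hf
  have hd : w.natDegree ≠ 0 := by
    intro hd
    have : w = 1 := hw.1.natDegree_eq_zero.1 hd
    subst this
    simp [𝒰.neBot.ne] at ht
  obtain ⟨L, hL⟩ := hw.exists_root_bound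
  refine ⟨w.natDegree * M + 1, exists_pow_le_of_pow_le_mul (K := max L 1 ^ M * K)
    (by simpa using hcons.norm) (fun k => norm_nonneg _) (fun k => abs_nonneg _) ?_⟩
  have hy1 : ∀ᶠ k in 𝒰, ‖y k‖ < 1 :=
    (show Tendsto (fun k => ‖y k‖) 𝒰 (𝓝 0) by simpa using hy.norm).eventually
      (gt_mem_nhds one_pos)
  filter_upwards [hfK, hM, ht, hy.eventually hL, hy1] with k h1 h2 h3 h4 h5
  rw [pow_mul]
  refine (pow_le_pow_left₀ (by positivity) (norm_cons_pow_le hd (h4 _ h3).1 h5.le) M).trans ?_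
  rw [mul_pow, mul_assoc]
  exact mul_le_mul_of_nonneg_left (h2.trans h1) (by positivity)

theorem good_cons_zero {l : Filter ℕ} {t : ℕ → ℝ} (ht : Tendsto t l (𝓝 0)) {y : ℕ → Fin n → ℝ}
    (hy : ∀ᶠ k in l, y k = 0) : Good l (fun k => (Fin.cons (t k) (y k) : Fin (n + 1) → ℝ)) := by
  intro h hh
  by_cases h0 : ∀ᶠ t : ℝ in 𝓝 0, h (Fin.cons t 0) = 0
  · left
    filter_upwards [ht.eventually h0, hy] with k h1 h2
    rw [h2, h1]
  right
  obtain ⟨d, g, hg, hg0, hhg⟩ :=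
    (analyticAt_cons_zero hh).exists_eventuallyEq_pow_smul_nonzero_iff.2 h0
  simp only [sub_zero, smul_eq_mul] at hhg
  have hy' : Tendsto y l (𝓝 0) := tendsto_const_nhds.congr' (hy.mono fun k hk => hk.symm)
  refine ⟨d + 1, exists_pow_le_of_pow_le_mul (K := (|g 0| / 2)⁻¹)
    (by simpa using (tendsto_cons hy' ht).norm) (fun k => norm_nonneg _) (fun k => abs_nonneg _) ?_⟩
  have hg1 : ∀ᶠ t in 𝓝 0, |g 0| / 2 < |g t| :=
    hg.continuousAt.abs.eventually (lt_mem_nhds (half_lt_self (abs_pos.2 hg0)))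
  filter_upwards [ht.eventually hg1, ht.eventually hhg, hy] with k h1 h2 h3
  have h4 : ‖(Fin.cons (t k) (y k) : Fin (n + 1) → ℝ)‖ ≤ |t k| := by
    refine (pi_norm_le_iff_of_nonneg (abs_nonneg _)).2 fun i => ?_
    refine Fin.cases le_rfl (fun j => ?_) i
    simp [h3]
  have h5 : 0 < |g 0| / 2 := half_pos (abs_pos.2 hg0)
  rw [h3, h2, ← h3, abs_mul, abs_pow, inv_mul_eq_div, le_div_iff₀ h5]
  exact mul_le_mul (pow_le_pow_left₀ (norm_nonneg _) h4 _) h1.le h5.le (by positivity)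

end

section

open Filter Topology Set Polynomial

theorem exists_root_avoiding {P : ℝ[X]} (hP : P ≠ 0) {a₀ : ℝ} (ha₀ : P.eval a₀ = 0) {c : ℝ}
    (hc : 0 < c) {t : ℝ} (ht : P.eval t ≠ 0) :
    ∃ τ, (P.derivative.eval τ = 0 ∨ P.eval (τ + -c) = 0 ∨ P.eval (τ + c) = 0) ∧
      ∀ s ∈ uIcc τ t, P.eval s ≠ 0 := by
  set A := P.roots.toFinset.filter (· < t)
  set B := P.roots.toFinset.filter (t < ·)
  have hA : ∀ s, s ∈ A ↔ P.eval s = 0 ∧ s < t := by simp [A, hP]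
  have hB : ∀ s, s ∈ B ↔ P.eval s = 0 ∧ t < s := by simp [B, hP]
  rcases A.eq_empty_or_nonempty with hA0 | hA0 <;> rcases B.eq_empty_or_nonempty with hB0 | hB0
  · rcases lt_trichotomy a₀ t with h | h | h
    · simpa [hA0] using (hA a₀).2 ⟨ha₀, h⟩
    · exact absurd (h ▸ ha₀) ht
    · simpa [hB0] using (hB a₀).2 ⟨ha₀, h⟩
  · obtain ⟨h1, h2⟩ := (hB _).1 (B.min'_mem hB0)
    refine ⟨B.min' hB0 - c, Or.inr (Or.inr (by simpa using h1)), fun s hs h0 => ?_⟩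
    have h3 : s < B.min' hB0 := hs.2.trans_lt (max_lt (by linarith) h2)
    rcases lt_trichotomy s t with h | h | h
    · simpa [hA0] using (hA s).2 ⟨h0, h⟩
    · exact absurd (h ▸ h0) ht
    · exact absurd (B.min'_le s ((hB s).2 ⟨h0, h⟩)) (not_le.2 h3)
  · obtain ⟨h1, h2⟩ := (hA _).1 (A.max'_mem hA0)
    refine ⟨A.max' hA0 + c, Or.inr (Or.inl (by simpa using h1)), fun s hs h0 => ?_⟩
    have h3 : A.max' hA0 < s := (lt_min (by linarith) h2).trans_le hs.1
    rcases lt_trichotomy s t with h | h | h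
    · exact absurd (A.le_max' s ((hA s).2 ⟨h0, h⟩)) (not_le.2 h3)
    · exact absurd (h ▸ h0) ht
    · simpa [hB0] using (hB s).2 ⟨h0, h⟩
  · obtain ⟨h1, h2⟩ := (hA _).1 (A.max'_mem hA0)
    obtain ⟨h3, h4⟩ := (hB _).1 (B.min'_mem hB0)
    obtain ⟨τ, ⟨h5, h6⟩, h7⟩ := exists_hasDerivAt_eq_zero (h2.trans h4) P.continuousOn
      (h1.trans h3.symm) fun s _ => P.hasDerivAt s
    refine ⟨τ, Or.inl h7, fun s hs h0 => ?_⟩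
    have h8 : A.max' hA0 < s := (lt_min h5 h2).trans_le hs.1
    have h9 : s < B.min' hB0 := hs.2.trans_lt (max_lt h6 h4)
    rcases lt_trichotomy s t with h | h | h
    · exact absurd (A.le_max' s ((hA s).2 ⟨h0, h⟩)) (not_le.2 h8)
    · exact absurd (h ▸ h0) ht
    · exact absurd (B.min'_le s ((hB s).2 ⟨h0, h⟩)) (not_le.2 h9)

theorem sign_eval_eq_of_forall_ne {p : ℝ[X]} {a b : ℝ} (h : ∀ s ∈ uIcc a b, p.eval s ≠ 0) :
    SignType.sign (p.eval a) = SignType.sign (p.eval b) := by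
  have hno : (0 : ℝ) ∉ uIcc (p.eval a) (p.eval b) := fun h0 => by
    obtain ⟨s, hs, hs0⟩ := intermediate_value_uIcc p.continuousOn h0
    exact h s hs hs0
  rcases (h a left_mem_uIcc).lt_or_gt with h1 | h1 <;>
    rcases (h b right_mem_uIcc).lt_or_gt with h2 | h2
  · rw [sign_neg h1, sign_neg h2]
  · exact absurd (mem_uIcc.2 (Or.inl ⟨h1.le, h2.le⟩)) hno
  · exact absurd (mem_uIcc.2 (Or.inr ⟨h2.le, h1.le⟩)) hno
  · rw [sign_pos h1, sign_pos h2]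

variable {n : ℕ}

theorem exists_distinguished_sampling (S : Finset (Germs n)[X]) (hS : ∀ p ∈ S, Distinguished p)
    (hX : X ∈ S) : ∃ w : (Germs n)[X], Distinguished w ∧ ∀ e : Fin n → ℝ, e ≠ 0 → ∀ t, ∃ τ,
      (w.map (ev e)).eval τ = 0 ∧ ∀ p ∈ S,
        SignType.sign ((p.map (ev e)).eval t) = SignType.sign ((p.map (ev e)).eval τ) := by
  set W := ∏ p ∈ S, p
  have hW : Distinguished W := Distinguished.prod S hS
  have hdvd : ∀ p ∈ S, p ∣ W := fun p hp => Finset.dvd_prod_of_mem _ hp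
  have hd : W.natDegree ≠ 0 := fun h0 => not_isUnit_X
    (isUnit_of_dvd_one ((hdvd _ hX).trans (hW.1.natDegree_eq_zero.1 h0).dvd))
  have hN : AnalyticAt ℝ (fun e : Fin n → ℝ => ∑ i, e i ^ 2) 0 :=
    Finset.analyticAt_fun_sum _ fun i _ => AnalyticAt.pow
      ((ContinuousLinearMap.proj (R := ℝ) (φ := fun _ : Fin n => ℝ) i).analyticAt _) 2
  let N : Germs n := ⟨_, hN⟩
  have hN0 : ev 0 N = 0 := by simp [N, ev_apply]
  refine ⟨W * (C (algebraMap ℝ (Germs n) (W.natDegree : ℝ)⁻¹) * derivative W *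
    (W.comp (X + C (-N)) * W.comp (X + C N))), hW.mul ((hW.derivative hd).mul
      ((hW.comp_X_add_C (by rw [map_neg, hN0, neg_zero])).mul (hW.comp_X_add_C hN0))), ?_⟩
  intro e he t
  by_cases ht : (W.map (ev e)).eval t = 0
  · exact ⟨t, by simp [ht], fun p _ => rfl⟩
  have hpos : 0 < ev e N := by
    change 0 < ∑ i, e i ^ 2
    obtain ⟨i, hi⟩ := Function.ne_iff.1 he
    exact Finset.sum_pos' (fun j _ => sq_nonneg _) ⟨i, Finset.mem_univ _, by
      have : e i ≠ 0 := hi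
      positivity⟩
  have hW0 : (W.map (ev e)).eval 0 = 0 := by
    obtain ⟨v, hv⟩ := hdvd _ hX
    simp [hv]
  obtain ⟨τ, h1, h2⟩ := exists_root_avoiding (hW.1.map (ev e)).ne_zero hW0 hpos ht
  refine ⟨τ, ?_, fun p hp => ?_⟩
  · rw [derivative_map] at h1
    simp only [Polynomial.map_mul, eval_mul, Polynomial.map_comp, eval_comp, Polynomial.map_add,
      map_X, map_C, eval_add, eval_X, eval_C, map_neg]
    rcases h1 with h1 | h1 | h1 <;> simp [h1]
  · refine (sign_eval_eq_of_forall_ne fun s hs h0 => h2 s hs ?_).symm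
    obtain ⟨v, hv⟩ := hdvd p hp
    rw [hv, Polynomial.map_mul, eval_mul, h0, zero_mul]

/-- Every sequence tending to the origin can be replaced by a good one without changing the signs
of finitely many analytic germs. -/
def HasGoodPoints (𝒰 : Ultrafilter ℕ) (E : Type*) [NormedAddCommGroup E] [NormedSpace ℝ E] : Prop :=
  ∀ H : Set (E → ℝ), H.Finite → (∀ h ∈ H, AnalyticAt ℝ h 0) → ∀ x : ℕ → E, Tendsto x 𝒰 (𝓝 0) →
    ∃ y : ℕ → E, Tendsto y 𝒰 (𝓝 0) ∧ Good 𝒰 y ∧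
      ∀ h ∈ H, ∀ᶠ k in 𝒰, SignType.sign (h (x k)) = SignType.sign (h (y k))

theorem HasGoodPoints.congr {𝒰 : Ultrafilter ℕ} {E F : Type*} [NormedAddCommGroup E]
    [NormedSpace ℝ E] [NormedAddCommGroup F] [NormedSpace ℝ F] (hE : HasGoodPoints 𝒰 E)
    (σ : E ≃L[ℝ] F) : HasGoodPoints 𝒰 F := by
  intro H hH hHa x hx
  obtain ⟨y, h1, h2, h3⟩ := hE ((fun h => h ∘ σ) '' H) (hH.image _) (by
    rintro _ ⟨h, hh, rfl⟩
    exact AnalyticAt.comp_of_eq (hHa h hh) ((σ : E →L[ℝ] F).analyticAt _) (map_zero σ))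
    (fun k => σ.symm (x k)) ((σ.symm.continuous.tendsto' 0 0 (map_zero _)).comp hx)
  refine ⟨fun k => σ (y k), (σ.continuous.tendsto' 0 0 (map_zero _)).comp h1, h2.map h1 σ, ?_⟩
  intro h hh
  simpa using h3 _ ⟨h, hh, rfl⟩

theorem HasGoodPoints.exists_of_regular {𝒰 : Ultrafilter ℕ}
    (hn : HasGoodPoints 𝒰 (Fin n → ℝ)) {H : Set ((Fin (n + 1) → ℝ) → ℝ)} (hH : H.Finite)
    (hHa : ∀ h ∈ H, AnalyticAt ℝ h 0)
    (hreg : ∀ h ∈ H, ¬ ∀ᶠ t : ℝ in 𝓝 0, h (Fin.cons t 0) = 0)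
    {x : ℕ → Fin (n + 1) → ℝ} (hx : Tendsto x 𝒰 (𝓝 0)) :
    ∃ y : ℕ → Fin (n + 1) → ℝ, Tendsto y 𝒰 (𝓝 0) ∧ Good 𝒰 y ∧
      ∀ h ∈ H, ∀ᶠ k in 𝒰, SignType.sign (h (x k)) = SignType.sign (h (y k)) := by
  classical
  choose! w u hw hu hu0 hwu using fun h hh => exists_distinguished (hHa h hh) (hreg h hh)
  set S : Finset (Germs n)[X] := insert X (hH.toFinset.image w)
  have hS : ∀ p ∈ S, Distinguished p := by
    intro p hp
    rcases Finset.mem_insert.1 hp with rfl | hp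
    · exact Distinguished.X
    · obtain ⟨h, hh, rfl⟩ := Finset.mem_image.1 hp
      exact hw h (hH.mem_toFinset.1 hh)
  have hXS : X ∈ S := Finset.mem_insert_self _ _
  have hwS : ∀ h ∈ H, w h ∈ S := fun h hh =>
    Finset.mem_insert_of_mem (Finset.mem_image_of_mem _ (hH.mem_toFinset.2 hh))
  obtain ⟨H', hH', hsign⟩ := exists_finite_sign_determined (R := Germs n) S.finite_toSet
  have hx1 : Tendsto (fun k => Fin.tail (x k)) 𝒰 (𝓝 0) := by
    have hc : Tendsto (fun z : Fin (n + 1) → ℝ => (Fin.tail z : Fin n → ℝ)) (𝓝 0) (𝓝 0) :=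
      Continuous.tendsto' (continuous_pi fun j => continuous_apply _) _ _ rfl
    exact hc.comp hx
  have hx0 : Tendsto (fun k => x k 0) 𝒰 (𝓝 0) :=
    ((continuous_apply (0 : Fin (n + 1))).tendsto _).comp hx
  obtain ⟨y, hy, hyg, hys⟩ := hn ((fun f : Germs n => f.1) '' H') (hH'.image _)
    (by rintro _ ⟨f, _, rfl⟩; exact f.2) _ hx1
  have hT : ∀ᶠ k in 𝒰, ∃ t, ∀ p ∈ S, SignType.sign ((p.map (ev (Fin.tail (x k)))).eval (x k 0)) =
      SignType.sign ((p.map (ev (y k))).eval t) := by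
    filter_upwards [hH'.eventually_all.2 fun f hf => hys _ ⟨f, hf, rfl⟩] with k hk
    exact hsign _ _ hk (x k 0)
  obtain ⟨t, ht⟩ := hT.choice
  have key : ∃ τ : ℕ → ℝ, Tendsto τ 𝒰 (𝓝 0) ∧
      Good 𝒰 (fun k => (Fin.cons (τ k) (y k) : Fin (n + 1) → ℝ)) ∧
      ∀ p ∈ S, ∀ᶠ k in 𝒰, SignType.sign ((p.map (ev (y k))).eval (t k)) =
        SignType.sign ((p.map (ev (y k))).eval (τ k)) := by
    by_cases hy0 : ∀ᶠ k in 𝒰, y k = 0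
    · refine ⟨fun k => x k 0, hx0, good_cons_zero hx0 hy0, fun p hp => ?_⟩
      filter_upwards [hy0, ht] with k h1 h2
      have h3 := h2 X hXS
      simp only [map_X, eval_X] at h3
      rw [h1, (hS p hp).2]
      simp only [eval_pow, eval_X, sign_pow, h3]
    · obtain ⟨v, hv, hvs⟩ := exists_distinguished_sampling S hS hXS
      have h1 : ∀ᶠ k in 𝒰, ∃ τ, (v.map (ev (y k))).eval τ = 0 ∧ ∀ p ∈ S,
          SignType.sign ((p.map (ev (y k))).eval (t k)) =
            SignType.sign ((p.map (ev (y k))).eval τ) := by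
        filter_upwards [Ultrafilter.eventually_not.2 hy0] with k hk
        exact hvs _ hk _
      obtain ⟨τ, hτ⟩ := h1.choice
      have hroot := hτ.mono fun k hk => hk.1
      exact ⟨τ, hv.tendsto_root hy hroot, hyg.cons_root hy hv hroot,
        fun p hp => hτ.mono fun k hk => hk.2 p hp⟩
  obtain ⟨τ, hτ0, hτg, hτs⟩ := key
  refine ⟨_, tendsto_cons hy hτ0, hτg, fun h hh => ?_⟩
  have hxu := (hx1.prodMk_nhds hx0).eventually (hwu h hh)
  have hyu := (hy.prodMk_nhds hτ0).eventually (hwu h hh)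
  have hsu : ∀ᶠ p in 𝓝 (0 : (Fin n → ℝ) × ℝ), SignType.sign (u h p) = SignType.sign (u h 0) := by
    rcases (hu0 h hh).lt_or_gt with h1 | h1
    · filter_upwards [(hu h hh).eventually (gt_mem_nhds h1)] with p hp
      rw [sign_neg h1, sign_neg hp]
    · filter_upwards [(hu h hh).eventually (lt_mem_nhds h1)] with p hp
      rw [sign_pos h1, sign_pos hp]
  filter_upwards [hxu, hyu, (hx1.prodMk_nhds hx0).eventually hsu,
    (hy.prodMk_nhds hτ0).eventually hsu, ht, hτs _ (hwS h hh)] with k h1 h2 h3 h4 h5 h6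
  simp only [Fin.cons_self_tail] at h1
  rw [h1, h2, sign_mul, sign_mul, h3, h4, h5 _ (hwS h hh), h6]

end

section

open Filter Topology Set

theorem exists_open_forall_ne_zero {E : Type*} [NormedAddCommGroup E] [NormedSpace ℝ E] {r : ℝ}
    (hr : 0 < r) {H : Set (E → ℝ)} (hH : H.Finite)
    (hHa : ∀ h ∈ H, AnalyticOnNhd ℝ h (Metric.ball 0 r)) (h0 : ∀ h ∈ H, ¬ ∀ᶠ z in 𝓝 0, h z = 0) :
    ∃ V ⊆ Metric.ball (0 : E) r, IsOpen V ∧ V.Nonempty ∧ ∀ h ∈ H, ∀ v ∈ V, h v ≠ 0 := by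
  induction H, hH using Set.Finite.induction_on with
  | empty => exact ⟨_, subset_rfl, Metric.isOpen_ball, ⟨0, Metric.mem_ball_self hr⟩, by simp⟩
  | @insert h H _ _ ih =>
    obtain ⟨V, hVr, hVo, ⟨v, hv⟩, hV⟩ := ih (fun g hg => hHa g (mem_insert_of_mem _ hg))
      fun g hg => h0 g (mem_insert_of_mem _ hg)
    have hha := hHa h (mem_insert _ _)
    have hex : ∃ v' ∈ V, h v' ≠ 0 := by
      by_contra! hz
      refine h0 h (mem_insert _ _) ?_
      have h1 := hha.eqOn_zero_of_preconnected_of_eventuallyEq_zero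
        (convex_ball (0 : E) r).isPreconnected (hVr hv)
        (eventually_of_mem (hVo.mem_nhds hv) hz)
      exact eventually_of_mem (Metric.ball_mem_nhds _ hr) h1
    obtain ⟨v', hv', hne⟩ := hex
    have hcont : ContinuousOn h V := hha.continuousOn.mono hVr
    refine ⟨V ∩ h ⁻¹' {0}ᶜ, inter_subset_left.trans hVr,
      hcont.isOpen_inter_preimage hVo isOpen_compl_singleton, ⟨v', hv', hne⟩, ?_⟩
    rintro g (rfl | hg) z ⟨hz1, hz2⟩
    · exact hz2
    · exact hV g hg z hz1

theorem exists_regular_direction {E : Type*} [NormedAddCommGroup E] [NormedSpace ℝ E]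
    {H : Set (E → ℝ)} (hH : H.Finite) (hHa : ∀ h ∈ H, AnalyticAt ℝ h 0)
    (h0 : ∀ h ∈ H, ¬ ∀ᶠ z in 𝓝 0, h z = 0) :
    ∃ v : E, ∀ h ∈ H, ¬ ∀ᶠ t : ℝ in 𝓝 0, h (t • v) = 0 := by
  obtain ⟨r, hr, hrH⟩ := Metric.eventually_nhds_iff_ball.1
    (hH.eventually_all.2 fun h hh => (hHa h hh).eventually_analyticAt)
  have hHr : ∀ h ∈ H, AnalyticOnNhd ℝ h (Metric.ball 0 r) := fun h hh z hz => hrH z hz h hh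
  obtain ⟨V, hVr, -, ⟨v, hv⟩, hV⟩ := exists_open_forall_ne_zero hr hH hHr h0
  refine ⟨v, fun h hh hz => hV h hh v hv ?_⟩
  let L : ℝ →L[ℝ] E := (ContinuousLinearMap.id ℝ ℝ).smulRight v
  have hconv : Convex ℝ (L ⁻¹' Metric.ball 0 r) :=
    (convex_ball (0 : E) r).linear_preimage L.toLinearMap
  have han : AnalyticOnNhd ℝ (h ∘ L) (L ⁻¹' Metric.ball 0 r) := fun t ht =>
    (hHr h hh _ ht).comp (L.analyticAt t)
  have h1 := han.eqOn_zero_of_preconnected_of_eventuallyEq_zero hconv.isPreconnected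
    (z₀ := 0) (by simpa using hr) hz
  have h2 := h1 (x := 1) (by simpa [L] using hVr hv)
  simpa [L] using h2

theorem hasGoodPoints_pi (𝒰 : Ultrafilter ℕ) (n : ℕ) : HasGoodPoints 𝒰 (Fin n → ℝ) := by
  induction n with
  | zero =>
    intro H hH hHa x hx
    refine ⟨x, hx, fun h hh => ?_, fun h hh => Eventually.of_forall fun k => rfl⟩
    by_cases h0 : h 0 = 0
    · exact Or.inl (Eventually.of_forall fun k => by rwa [Subsingleton.elim (x k) 0])
    · refine Or.inr ⟨1, Eventually.of_forall fun k => ?_⟩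
      rw [Subsingleton.elim (x k) 0, norm_zero, pow_one]
      exact abs_nonneg _
  | succ n ih =>
    intro H hH hHa x hx
    set H₁ : Set ((Fin (n + 1) → ℝ) → ℝ) := {h ∈ H | ¬ ∀ᶠ z in 𝓝 0, h z = 0}
    have hH₁ : H₁.Finite := hH.subset (sep_subset _ _)
    have hcoord : ¬ ∀ᶠ z : Fin (n + 1) → ℝ in 𝓝 0, z 0 = 0 := fun hz => by
      have hc : Tendsto (fun t : ℝ => (fun _ : Fin (n + 1) => t)) (𝓝[≠] 0) (𝓝 0) :=
        (Continuous.tendsto' (by fun_prop) _ _ rfl).mono_left nhdsWithin_le_nhds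
      obtain ⟨t, h1, h2⟩ := ((hc.eventually hz).and self_mem_nhdsWithin).exists
      exact h2 h1
    obtain ⟨v, hv⟩ := exists_regular_direction (hH₁.insert fun z => z 0)
      (by
        rintro h (rfl | hh)
        · exact (ContinuousLinearMap.proj (R := ℝ) (φ := fun _ : Fin (n + 1) => ℝ) 0).analyticAt _
        · exact hHa h hh.1)
      (by
        rintro h (rfl | hh)
        · exact hcoord
        · exact hh.2)
    have hv0 : v ≠ 0 := by
      rintro rfl
      exact hv _ (mem_insert _ _) (by simp)
    obtain ⟨σ, hσ⟩ := SeparatingDual.exists_continuousLinearEquiv_apply_eq (R := ℝ)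
      (x := (Fin.cons 1 0 : Fin (n + 1) → ℝ)) (y := v) (fun h => one_ne_zero (congrFun h 0)) hv0
    have hσt : ∀ t : ℝ, σ (Fin.cons t 0) = t • v := fun t => by
      rw [← hσ, ← map_smul]
      congr 1
      funext i
      refine Fin.cases ?_ (fun j => ?_) i <;> simp
    obtain ⟨y, h1, h2, h3⟩ := ih.exists_of_regular (H := (fun h => h ∘ σ) '' H₁) (hH₁.image _)
      (by
        rintro _ ⟨h, hh, rfl⟩
        exact AnalyticAt.comp_of_eq (hHa h hh.1)
          ((σ : (Fin (n + 1) → ℝ) →L[ℝ] (Fin (n + 1) → ℝ)).analyticAt _) (map_zero σ))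
      (by
        rintro _ ⟨h, hh, rfl⟩
        simpa only [Function.comp_apply, hσt] using hv h (mem_insert_of_mem _ hh))
      ((σ.symm.continuous.tendsto' 0 0 (map_zero _)).comp hx)
    have hσy := (σ.continuous.tendsto' 0 0 (map_zero _)).comp h1
    refine ⟨fun k => σ (y k), hσy, h2.map h1 σ, fun h hh => ?_⟩
    by_cases hz : ∀ᶠ z in 𝓝 0, h z = 0
    · filter_upwards [hx.eventually hz, hσy.eventually hz] with k h4 h5
      rw [h4]
      exact congrArg _ h5.symm
    · simpa using h3 _ ⟨h, ⟨hh, hz⟩, rfl⟩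

/-- A form of the curve selection lemma: in a finite-dimensional space, sequences tending to the
origin can be replaced by good ones with the same signs. -/
theorem hasGoodPoints (𝒰 : Ultrafilter ℕ) (E : Type*) [NormedAddCommGroup E] [NormedSpace ℝ E]
    [FiniteDimensional ℝ E] : HasGoodPoints 𝒰 E :=
  (hasGoodPoints_pi 𝒰 _).congr (Module.finBasis ℝ E).equivFunL.symm

end

section

open Filter Topology Set

theorem not_eventually_exp_le {l : Filter ℕ} [l.NeBot] {r : ℕ → ℝ} (hr : Tendsto r l atTop) (C : ℝ)
    (hC : 0 < C) (M N : ℕ) (h : ∀ᶠ k in l, Real.exp (r k) ≤ C * (1 + r k ^ M) ^ N) : False := by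
  have h1 := (Real.tendsto_pow_mul_exp_neg_atTop_nhds_zero (M * N)).comp hr
  have h2 : ∀ᶠ k in l, r k ^ (M * N) * Real.exp (-r k) < (C * 2 ^ N)⁻¹ :=
    h1.eventually (gt_mem_nhds (by positivity))
  obtain ⟨k, h3, h4, h5⟩ := (h.and (h2.and (hr.eventually_ge_atTop 1))).exists
  have h6 : 1 ≤ r k ^ M := one_le_pow₀ h5
  have h7 : Real.exp (r k) ≤ C * 2 ^ N * r k ^ (M * N) := by
    refine h3.trans ?_
    rw [mul_assoc, pow_mul, ← mul_pow]
    gcongr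
    linarith
  rw [Real.exp_neg, ← div_eq_mul_inv, div_lt_iff₀ (Real.exp_pos _), inv_mul_eq_div,
    lt_div_iff₀ (by positivity)] at h4
  linarith

theorem Semianalytic.exists_piece {E : Type*} [NormedAddCommGroup E] [NormedSpace ℝ E] {A : Set E}
    (hA : Semianalytic A) {𝒰 : Ultrafilter ℕ} {x : ℕ → E} {a : E} (hx : Tendsto x 𝒰 (𝓝 a))
    (hxA : ∀ᶠ k in 𝒰, x k ∈ A) :
    ∃ (N : ℕ) (f g : Fin N → E → ℝ), (∀ j, AnalyticAt ℝ (f j) a) ∧ (∀ j, AnalyticAt ℝ (g j) a) ∧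
      (∀ᶠ k in 𝒰, ∀ j, f j (x k) = 0 ∧ 0 < g j (x k)) ∧
      ∀ᶠ y in 𝓝 a, (∀ j, f j y = 0 ∧ 0 < g j y) → y ∈ A := by
  obtain ⟨U, hU, haU, N, f, g, hf, hg, hAU⟩ := hA a
  have hUx := hx.eventually (hU.mem_nhds haU)
  have hmem : ∀ y ∈ U, (y ∈ A ↔ ∃ i, ∀ j, f i j y = 0 ∧ 0 < g i j y) := fun y hy => by
    have := Set.ext_iff.1 hAU y
    simpa [hy] using this
  have hex : ∃ i, ∀ᶠ k in 𝒰, ∀ j, f i j (x k) = 0 ∧ 0 < g i j (x k) := by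
    by_contra hne
    have h1 := eventually_all.2 fun i => Ultrafilter.eventually_not.2 (not_exists.1 hne i)
    obtain ⟨k, h2, h3, h4⟩ := (h1.and (hxA.and hUx)).exists
    obtain ⟨i, hi⟩ := (hmem _ h4).1 h3
    exact h2 i hi
  obtain ⟨i, hi⟩ := hex
  refine ⟨N, f i, g i, fun j => hf i j a haU, fun j => hg i j a haU, hi, ?_⟩
  filter_upwards [hU.mem_nhds haU] with y hy h1
  exact (hmem y hy).2 ⟨i, h1⟩

/-- If a set that is subanalytic at the origin of `ℂ` contains points `w` tending to `0` with
`Re w⁻¹` tending to `+∞`, then it contains such points along which moreover `|w⁻¹|²` is bounded by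
a power of `Re w⁻¹`. -/
theorem SubanalyticAt.exists_re_inv_growth {s : Set ℂ} (hs : SubanalyticAt s 0) {𝒰 : Ultrafilter ℕ}
    {w : ℕ → ℂ} (hw : ∀ᶠ k in 𝒰, w k ∈ s) (hw0 : Tendsto w 𝒰 (𝓝 0))
    (hre : Tendsto (fun k => (w k)⁻¹.re) 𝒰 atTop) :
    ∃ (v : ℕ → ℂ) (M : ℕ), (∀ᶠ k in 𝒰, v k ∈ s ∧ v k ≠ 0) ∧
      Tendsto (fun k => (v k)⁻¹.re) 𝒰 atTop ∧
      ∀ᶠ k in 𝒰, Complex.normSq (v k)⁻¹ ≤ (v k)⁻¹.re ^ M := by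
  obtain ⟨U, hU, h0U, m, A, hA, hAc, hsA⟩ := hs
  have hmem : ∀ z ∈ U, (z ∈ s ↔ ∃ p, (z, p) ∈ A) := fun z hz => by
    have := Set.ext_iff.1 hsA z
    simpa [hz] using this
  have hpex : ∀ᶠ k in 𝒰, ∃ p, (w k, p) ∈ A := by
    filter_upwards [hw, hw0.eventually (hU.mem_nhds h0U)] with k h1 h2
    exact (hmem _ h2).1 h1
  obtain ⟨p, hp⟩ := hpex.choice
  obtain ⟨⟨w₀, p₀⟩, -, ha⟩ := hAc.ultrafilter_le_nhds (𝒰.map fun k => (w k, p k))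
    (le_principal_iff.2 (hp.mono fun k hk => subset_closure hk))
  replace ha : Tendsto (fun k => (w k, p k)) 𝒰 (𝓝 (w₀, p₀)) := ha
  obtain rfl : w₀ = 0 := tendsto_nhds_unique ((continuous_fst.tendsto _).comp ha) hw0
  obtain ⟨N, f, g, hf, hg, hfg, hback⟩ := hA.exists_piece ha hp
  let E := (ℂ × EuclideanSpace ℝ (Fin m)) × ℝ
  set x : ℕ → E := fun k => ((w k, p k) - (0, p₀), ((w k)⁻¹.re)⁻¹)
  have hx : Tendsto x 𝒰 (𝓝 0) := by
    have h1 := ha.sub_const (0, p₀)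
    rw [sub_self] at h1
    exact h1.prodMk_nhds (tendsto_inv_atTop_zero.comp hre)
  let T : E → ℂ × EuclideanSpace ℝ (Fin m) := fun v => v.1 + (0, p₀)
  have hT : AnalyticAt ℝ T 0 := analyticAt_fst.add analyticAt_const
  have hT0 : T 0 = (0, p₀) := zero_add _
  have hW : AnalyticAt ℝ (fun v : E => v.1.1) 0 := analyticAt_fst.comp analyticAt_fst
  have hWre : AnalyticAt ℝ (fun v : E => v.1.1.re) 0 := (Complex.reCLM.analyticAt _).comp hW
  have hWim : AnalyticAt ℝ (fun v : E => v.1.1.im) 0 := (Complex.imCLM.analyticAt _).comp hW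
  have hsq : AnalyticAt ℝ (fun v : E => Complex.normSq v.1.1) 0 :=
    (hWre.mul hWre).add (hWim.mul hWim)
  have hs : AnalyticAt ℝ (fun v : E => v.2) 0 := analyticAt_snd
  have hrel : AnalyticAt ℝ (fun v : E => v.2 * v.1.1.re - Complex.normSq v.1.1) 0 :=
    (hs.mul hWre).sub hsq
  let H : Set (E → ℝ) := range (fun j v => f j (T v)) ∪ (range (fun j v => g j (T v)) ∪
    {fun v => Complex.normSq v.1.1, fun v => v.2, fun v => v.2 * v.1.1.re - Complex.normSq v.1.1})
  obtain ⟨y, hy, hgood, hsign⟩ := hasGoodPoints 𝒰 E H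
    ((finite_range _).union ((finite_range _).union (toFinite _)))
    (by
      rintro _ (⟨j, rfl⟩ | ⟨j, rfl⟩ | rfl | rfl | rfl)
      · exact AnalyticAt.comp_of_eq (hf j) hT hT0
      · exact AnalyticAt.comp_of_eq (hg j) hT hT0
      · exact hsq
      · exact hs
      · exact hrel) x hx
  have hTx : ∀ k, T (x k) = (w k, p k) := fun k => sub_add_cancel _ _
  have hx1 : ∀ k, (x k).1.1 = w k := fun k => sub_zero _
  have hxpos : ∀ᶠ k in 𝒰, 0 < (w k)⁻¹.re := hre.eventually_gt_atTop 0
  have hwne : ∀ᶠ k in 𝒰, w k ≠ 0 := hxpos.mono fun k hk h0 => by simp [h0] at hk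
  have hyfg : ∀ᶠ k in 𝒰, ∀ j, f j (T (y k)) = 0 ∧ 0 < g j (T (y k)) := by
    refine eventually_all.2 fun j => ?_
    filter_upwards [hfg, hsign _ (Or.inl ⟨j, rfl⟩), hsign _ (Or.inr (Or.inl ⟨j, rfl⟩))] with
      k h1 h2 h3
    rw [hTx, (h1 j).1, sign_zero, eq_comm, sign_eq_zero_iff] at h2
    rw [hTx, sign_pos (h1 j).2, eq_comm, sign_eq_one_iff] at h3
    exact ⟨h2, h3⟩
  have hysq : ∀ᶠ k in 𝒰, 0 < Complex.normSq (y k).1.1 := by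
    filter_upwards [hwne, hsign _ (Or.inr (Or.inr (Or.inl rfl)))] with k h1 h2
    rwa [hx1, sign_pos (Complex.normSq_pos.2 h1), eq_comm, sign_eq_one_iff] at h2
  have hys : ∀ᶠ k in 𝒰, 0 < (y k).2 := by
    filter_upwards [hxpos, hsign _ (Or.inr (Or.inr (Or.inr (Or.inl rfl))))] with k h1 h2
    rwa [sign_pos (show 0 < (x k).2 from inv_pos.2 h1), eq_comm, sign_eq_one_iff] at h2
  have hyre : ∀ᶠ k in 𝒰, ((y k).1.1)⁻¹.re = ((y k).2)⁻¹ := by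
    filter_upwards [hxpos, hwne, hysq, hys, hsign _ (Or.inr (Or.inr (Or.inr (Or.inr rfl))))] with
      k h1 h2 h3 h4 h5
    have h6 : (x k).2 * (x k).1.1.re - Complex.normSq (x k).1.1 = 0 := by
      rw [hx1]
      change ((w k)⁻¹.re)⁻¹ * (w k).re - _ = 0
      have h7 : Complex.normSq (w k) ≠ 0 := (Complex.normSq_pos.2 h2).ne'
      rw [Complex.inv_re] at h1 ⊢
      have h8 : (w k).re ≠ 0 := fun h8 => by simp [h8] at h1
      field_simp
      ring
    rw [h6, sign_zero, eq_comm, sign_eq_zero_iff, sub_eq_zero] at h5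
    rw [Complex.inv_re, ← h5]
    have h9 : (y k).1.1.re ≠ 0 := fun h9 => by simp [← h5, h9] at h3
    field_simp
  obtain ⟨M, hM⟩ := (hgood _ hsq).resolve_left fun h0 => by
    obtain ⟨k, h1, h2⟩ := (h0.and hysq).exists
    exact h2.ne' h1
  refine ⟨fun k => (y k).1.1, M, ?_, ?_, ?_⟩
  · have h1 : Tendsto (fun k => T (y k)) 𝒰 (𝓝 (0, p₀)) := hT0 ▸ hT.continuousAt.tendsto.comp hy
    filter_upwards [hyfg, hysq, h1.eventually hback, (hW.continuousAt.tendsto.comp hy).eventually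
      (hU.mem_nhds h0U)] with k h2 h3 h4 h5
    have h6 := h4 h2
    have h7 : T (y k) = ((y k).1.1, (y k).1.2 + p₀) := Prod.ext (add_zero _) rfl
    rw [h7] at h6
    exact ⟨(hmem _ h5).2 ⟨_, h6⟩, Complex.normSq_pos.1 h3⟩
  · refine Tendsto.congr' (hyre.mono fun k hk => hk.symm) ?_
    refine tendsto_inv_nhdsGT_zero.comp (tendsto_nhdsWithin_iff.2 ⟨?_, hys⟩)
    exact (continuous_snd.tendsto _).comp hy
  · filter_upwards [hyre, hM, hys, hysq] with k h1 h2 h3 h4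
    rw [h1, map_inv₀, inv_pow]
    refine inv_anti₀ (by positivity) ?_
    rw [abs_of_pos h4] at h2
    refine le_trans (pow_le_pow_left₀ h3.le ?_ _) h2
    exact (le_abs_self _).trans (norm_snd_le (y k))

end

/-- **Lemma 7.2** of Kashiwara–Schapira, *Ind-sheaves, temperate holomorphic
functions and irregularity*: let `W` be an open subanalytic subset of `ℙ¹(ℂ)`
with `∞ ∉ W`.  If, for some `C > 0` and positive integer `N`,
`exp x ≤ C (1 + x² + y²)^N` for all `z = x + i y ∈ W`, then there is a constant
`B` such that `x ≤ B` on `W`. -/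
theorem re_bounded_of_exp_le_poly
    (W : Set (OnePoint ℂ)) (hWopen : IsOpen W) (hWsa : SubanalyticP1 W)
    (hWinf : (∞ : OnePoint ℂ) ∉ W)
    (C : ℝ) (hC : 0 < C) (N : ℕ) (hN : 0 < N)
    (hbound : ∀ z : ℂ, (z : OnePoint ℂ) ∈ W →
      Real.exp z.re ≤ C * (1 + z.re ^ 2 + z.im ^ 2) ^ N) :
    ∃ B : ℝ, ∀ z : ℂ, (z : OnePoint ℂ) ∈ W → z.re ≤ B := by
  by_contra! hne
  choose z hzW hz using fun k : ℕ => hne k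
  have hre : Filter.Tendsto (fun k => (z k).re) (Filter.hyperfilter ℕ) Filter.atTop :=
    (Filter.tendsto_atTop_mono (fun k => (hz k).le) tendsto_natCast_atTop_atTop).mono_left
      Nat.hyperfilter_le_atTop
  have hw0 : Filter.Tendsto (fun k => (z k)⁻¹) (Filter.hyperfilter ℕ) (nhds 0) :=
    Filter.tendsto_inv₀_cobounded.comp (tendsto_norm_atTop_iff_cobounded.1
      (Filter.tendsto_atTop_mono (fun k => Complex.re_le_norm (z k)) hre))
  have hz0 : ∀ k, z k ≠ 0 := fun k h0 => by
    have h1 := hz k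
    rw [h0, Complex.zero_re] at h1
    exact absurd h1 (not_lt.2 k.cast_nonneg)
  obtain ⟨v, M, hv, hvre, hvM⟩ := hWsa.2.exists_re_inv_growth
    (w := fun k => (z k)⁻¹) (Filter.Eventually.of_forall fun k => by simpa [hz0 k] using hzW k)
    hw0 (by simpa using hre)
  refine not_eventually_exp_le hvre C hC M N ?_
  filter_upwards [hv, hvM] with k ⟨h1, h2⟩ h3
  have h4 : (((v k)⁻¹ : ℂ) : OnePoint ℂ) ∈ W := by simpa [h2] using h1
  refine (hbound _ h4).trans ?_
  rw [Complex.normSq_apply] at h3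
  refine mul_le_mul_of_nonneg_left (pow_le_pow_left₀ (by positivity) ?_ N) hC.le
  rw [sq, sq, add_assoc]
  exact add_le_add_right h3 1

end KS
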